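/- Let f : ℝⁿ → ℝ be real analytic and let p be a local minimum of f. Suppose γ : [0,∞) → ℝⁿ is a gradient flow of f such that for some sequence t_j → ∞ one has γ(t_j) → p. Then γ(t) → p as t → ∞. -/

import Mathlib

open Filter

section
open IsLocalRing

/-- In a Noetherian local domain whose maximal ideal is minimal over `a`,
every nonzero `c` divides a power of `a`. -/
theorem dvd_pow_of_minimal {R : Type*} [CommRing R] [IsDomain R] [IsNoetherianRing R]
    [IsLocalRing R] (a : R) (hp : maximalIdeal R ∈ (Ideal.span {a}).minimalPrimes)
    (c : R) (hc : c ≠ 0) : ∃ m, c ∣ a ^ m := by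
  have key : a ∈ (Ideal.span {c}).radical := by
    rw [Ideal.radical_eq_sInf, Submodule.mem_sInf]
    rintro (q : Ideal R) ⟨hq, hqp⟩
    have hle : q ≤ maximalIdeal R := le_maximalIdeal hqp.ne_top
    rcases hle.eq_or_lt with h | h
    · rw [h]; exact hp.1.2 (Ideal.mem_span_singleton_self a)
    · exfalso
      have h1 := Ideal.height_le_one_of_isPrincipal_of_mem_minimalPrimes _ _ hp
      have h2 : q.height + 1 ≤ (maximalIdeal R).height := by
        have := Ideal.height_add_one_le_of_lt_of_isPrime h
        exact this
      have h3 : (1 : ℕ∞) ≤ q.height := by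
        have hbot : (⊥ : Ideal R) < q := by
          refine bot_lt_iff_ne_bot.2 ?_
          rintro rfl
          exact hc (by simpa using hq (Ideal.mem_span_singleton_self c))
        have := Ideal.height_add_one_le_of_lt_of_isPrime hbot
        exact le_trans le_add_self this
      have : (2 : ℕ∞) ≤ 1 := le_trans (by
        calc (2 : ℕ∞) = 1 + 1 := by norm_num
          _ ≤ q.height + 1 := by gcongr
          _ ≤ _ := h2) h1
      exact absurd this (by norm_num)
  obtain ⟨m, hm⟩ := key
  exact ⟨m, Ideal.mem_span_singleton.1 hm⟩

/-- Krull–Akizuki key step: `W = a^{-N} R ∩ W + a W`. -/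
theorem krull_akizuki_aux {R K : Type*} [CommRing R] [IsDomain R] [IsNoetherianRing R]
    [IsLocalRing R] [Field K] [Algebra R K] [IsFractionRing R K] (a : R) (ha : a ≠ 0)
    (hp : maximalIdeal R ∈ (Ideal.span {a}).minimalPrimes)
    (W : Subring K) (hW : ∀ r, algebraMap R K r ∈ W) :
    ∃ N, ∀ x ∈ W, ∃ r : R, ∃ y ∈ W, x = algebraMap R K r / algebraMap R K a ^ N
      + algebraMap R K a * y := by
  have haK : algebraMap R K a ≠ 0 := by simpa using ha
  set g := algebraMap R K with hg
  -- the decreasing chain of ideals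
  let I : ℕ → Ideal R := fun n =>
    { carrier := {r | ∃ y ∈ W, ∃ d : R, g r = g a ^ n * y + g a * g d}
      add_mem' := by
        rintro r s ⟨y, hy, d, h⟩ ⟨y', hy', d', h'⟩
        exact ⟨y + y', W.add_mem hy hy', d + d', by rw [map_add, h, h', map_add]; ring⟩
      zero_mem' := ⟨0, W.zero_mem, 0, by simp⟩
      smul_mem' := by
        rintro c r ⟨y, hy, d, h⟩
        exact ⟨g c * y, W.mul_mem (hW c) hy, c * d, by
          rw [smul_eq_mul, map_mul, h, map_mul]; ring⟩ }
  have hmono : Antitone I := by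
    refine antitone_nat_of_succ_le ?_
    rintro n r ⟨y, hy, d, h⟩
    exact ⟨g a * y, W.mul_mem (hW a) hy, d, by rw [h]; ring⟩
  have hart : IsArtinianRing (R ⧸ Ideal.span {a}) :=
    quotient_artinian_of_mem_minimalPrimes_of_isLocalRing _ hp
  let q := Ideal.Quotient.mk (Ideal.span {a})
  obtain ⟨N, hN⟩ := IsArtinian.monotone_stabilizes
    (⟨fun n => OrderDual.toDual ((I n).map q), fun m n h => Ideal.map_mono (hmono h)⟩ :
      ℕ →o (Ideal (R ⧸ Ideal.span {a}))ᵒᵈ)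
  have haI : ∀ n, Ideal.span {a} ≤ I n := by
    intro n
    rw [Ideal.span_singleton_le_iff_mem]
    exact ⟨0, W.zero_mem, 1, by simp⟩
  have hst : ∀ m, N ≤ m → I m ≤ I (m + 1) := by
    intro m hm
    have h1 : (I m).map q = (I (m+1)).map q := by
      have e1 := hN m hm
      have e2 := hN (m+1) (by omega)
      exact (OrderDual.toDual.injective (e1.symm.trans e2))
    have : ∀ n, ((I n).map q).comap q = I n := by
      intro n
      rw [Ideal.comap_map_of_surjective _ Ideal.Quotient.mk_surjective]
      have : Ideal.comap q ⊥ = Ideal.span {a} := by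
        rw [← RingHom.ker_eq_comap_bot, Ideal.mk_ker]
      rw [this]; exact sup_eq_left.2 (haI n)
    rw [← this m, h1, this (m+1)]
  refine ⟨N, ?_⟩
  have main : ∀ m, ∀ x ∈ W, (∃ b : R, x = g b / g a ^ m) → ∃ r : R, ∃ y ∈ W,
      x = g r / g a ^ N + g a * y := by
    intro m
    induction m with
    | zero =>
      rintro x hx ⟨b, rfl⟩
      refine ⟨b * a ^ N, 0, W.zero_mem, ?_⟩
      rw [map_mul, map_pow]; field_simp; simp
    | succ m ih =>
      rintro x hx ⟨b, hb⟩
      by_cases hm : m + 1 ≤ N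
      · refine ⟨b * a ^ (N - (m+1)), 0, W.zero_mem, ?_⟩
        rw [hb, map_mul, map_pow]
        have : g a ^ N = g a ^ (m+1) * g a ^ (N - (m+1)) := by
          rw [← pow_add]; congr 1; omega
        rw [this]; field_simp; simp
      · have hb' : b ∈ I (m+1) := ⟨x, hx, 0, by rw [hb]; field_simp; simp⟩
        obtain ⟨y, hy, d, h⟩ := hst (m+1) (by omega) hb'
        have hxe : x = g a * y + g d / g a ^ m := by
          rw [hb, h]; field_simp; ring
        have hdW : g d / g a ^ m ∈ W := by
          have : g d / g a ^ m = x - g a * y := by rw [hxe]; ring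
          rw [this]; exact W.sub_mem hx (W.mul_mem (hW a) hy)
        obtain ⟨r, z, hz, h2⟩ := ih _ hdW ⟨d, rfl⟩
        exact ⟨r, y + z, W.add_mem hy hz, by rw [hxe, h2]; ring⟩
  intro x hx
  obtain ⟨b, c, hc, hbc⟩ := IsFractionRing.div_surjective (A := R) x
  have hc0 : c ≠ 0 := nonZeroDivisors.ne_zero hc
  obtain ⟨m, e, he⟩ := dvd_pow_of_minimal a hp c hc0
  refine main m x hx ⟨b * e, ?_⟩
  have hcK : g c ≠ 0 := by simpa [hg] using hc0
  change g b / g c = x at hbc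
  rw [← hbc, ← map_pow, he, map_mul, map_mul]
  have heK : g e ≠ 0 := by
    intro h0
    have : e = 0 := by simpa [hg] using h0
    rw [this, mul_zero] at he
    exact pow_ne_zero _ ha he
  field_simp

theorem dvr_local {R K : Type*} [CommRing R] [IsDomain R] [IsNoetherianRing R]
    [IsLocalRing R] [Field K] [Algebra R K] [IsFractionRing R K] (a : R) (ha : a ≠ 0)
    (hp : maximalIdeal R ∈ (Ideal.span {a}).minimalPrimes) :
    ∃ (W : ValuationSubring K) (hW : ∀ r, algebraMap R K r ∈ W) (t u : W) (k : ℕ),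
      maximalIdeal W = Ideal.span {t} ∧ t ≠ 0 ∧ IsUnit u ∧ 1 ≤ k ∧
      (⟨algebraMap R K a, hW a⟩ : W) = u * t ^ k := by
  obtain ⟨W, hW, hloc⟩ := IsLocalRing.exists_factor_valuationRing (algebraMap R K)
  have ham : a ∈ maximalIdeal R := hp.1.2 (Ideal.mem_span_singleton_self a)
  have hW' : ∀ r, algebraMap R K r ∈ W := hW
  obtain ⟨N, hN⟩ := krull_akizuki_aux (K := K) a ha hp W.toSubring hW
  let φ : R →+* W := (algebraMap R K).codRestrict W.toSubring hW
  letI : Algebra R W := φ.toAlgebra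
  set f : W := φ a with hf
  have hf0 : f ≠ 0 := by
    intro h
    have := congrArg Subtype.val h
    exact ha (by simpa [hf, φ] using this)
  have hfnu : ¬ IsUnit f := by
    intro h
    exact ham (hloc.1 a h)
  -- W/f Noetherian
  have haK : algebraMap R K a ≠ 0 := by simpa using ha
  let Q := W ⧸ Ideal.span {f}
  have hnoeth : IsNoetherian R Q := by
    let N0 : Ideal R :=
      { carrier := {r | algebraMap R K r / algebraMap R K a ^ N ∈ W}
        add_mem' := by
          intro r s hr hs
          simp only [Set.mem_ofPred_eq] at *
          rw [map_add, add_div]; exact W.add_mem _ _ hr hs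
        zero_mem' := by simp [W.zero_mem]
        smul_mem' := by
          intro c r hr
          simp only [Set.mem_ofPred_eq, smul_eq_mul] at *
          rw [map_mul, mul_div_assoc]; exact W.mul_mem _ _ (hW' c) hr }
    let L : N0 →ₗ[R] Q :=
      { toFun := fun r => Ideal.Quotient.mk _ ⟨algebraMap R K r.1 / algebraMap R K a ^ N, r.2⟩
        map_add' := by
          intro r s
          rw [← map_add]; congr 1
          apply Subtype.ext
          simp [add_div]
        map_smul' := by
          intro c r
          rw [Algebra.smul_def]
          have : algebraMap R Q c = Ideal.Quotient.mk _ (φ c) := rfl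
          rw [RingHom.id_apply, this, ← map_mul]; congr 1
          apply Subtype.ext
          simp [φ, mul_div_assoc] }
    have hsurj : Function.Surjective L := by
      intro z
      obtain ⟨x, rfl⟩ := Ideal.Quotient.mk_surjective z
      obtain ⟨r, y, hy, h⟩ := hN x.1 x.2
      have hr : algebraMap R K r / algebraMap R K a ^ N ∈ W := by
        have : algebraMap R K r / algebraMap R K a ^ N = x.1 - algebraMap R K a * y := by
          rw [h]; ring
        rw [this]; exact sub_mem x.2 (W.mul_mem _ _ (hW' a) hy)
      refine ⟨⟨r, hr⟩, ?_⟩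
      change Ideal.Quotient.mk _ _ = _
      rw [Ideal.Quotient.eq, Ideal.mem_span_singleton]
      refine ⟨-⟨y, hy⟩, ?_⟩
      apply Subtype.ext
      simp [h, hf, φ]
    exact isNoetherian_of_surjective (f := L) (LinearMap.range_eq_top.2 hsurj)
  have hnr : IsNoetherianRing Q := isNoetherian_of_tower R hnoeth
  -- ideals above f are f.g.
  have hfg : (maximalIdeal W).FG := by
    have h1 : ((maximalIdeal W).map (Ideal.Quotient.mk (Ideal.span {f}))).FG :=
      hnr.noetherian _
    have h2 : Ideal.span {f} ≤ maximalIdeal W := by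
      rw [Ideal.span_singleton_le_iff_mem]; exact hfnu
    have hker : (RingHom.ker (Ideal.Quotient.mk (Ideal.span {f}))) ≤ maximalIdeal W := by
      rwa [Ideal.mk_ker]
    refine Submodule.fg_of_fg_map_of_fg_inf_ker
      (Submodule.mkQ (Ideal.span {f})) ?_ ?_
    · have hN2 : IsNoetherian W Q := isNoetherian_of_tower R hnoeth
      exact hN2.noetherian _
    · rw [Submodule.ker_mkQ, inf_eq_right.2 h2]
      exact ⟨{f}, by simp [Ideal.span]⟩
  obtain ⟨t, ht⟩ := IsBezout.isPrincipal_of_FG _ hfg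
  have ht' : maximalIdeal W = Ideal.span {t} := ht
  have htnu : ¬ IsUnit t := by
    have : t ∈ maximalIdeal W := by rw [ht']; exact Ideal.mem_span_singleton_self t
    exact this
  have hfm : f ∈ maximalIdeal W := hfnu
  have ht0 : t ≠ 0 := by
    rintro rfl
    rw [ht'] at hfm
    exact hf0 (by simpa using hfm)
  have hbound : ∃ k, ¬ t ^ k ∣ f := by
    by_contra hcon
    push Not at hcon
    choose c hc using hcon
    have hmon : Monotone (fun j => (Ideal.span {c j}).map (Ideal.Quotient.mk (Ideal.span {f}))) := by
      refine monotone_nat_of_le_succ fun j => Ideal.map_mono ?_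
      rw [Ideal.span_singleton_le_span_singleton]
      refine ⟨t, ?_⟩
      have := (hc j).symm.trans (hc (j+1))
      rw [pow_succ, mul_assoc] at this
      have := mul_left_cancel₀ (pow_ne_zero j ht0) this
      rw [this]; ring
    obtain ⟨n, hn⟩ := monotone_stabilizes_iff_noetherian.2 hnr ⟨_, hmon⟩
    have h1 := hn (n+1) (by omega)
    simp only [OrderHom.coe_mk] at h1
    have h2 : c (n+1) ∈ Ideal.span {c n} ⊔ Ideal.span {f} := by
      have h3 : Ideal.Quotient.mk (Ideal.span {f}) (c (n+1)) ∈
          (Ideal.span {c n}).map (Ideal.Quotient.mk (Ideal.span {f})) := by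
        rw [h1]; exact Ideal.mem_map_of_mem _ (Ideal.mem_span_singleton_self _)
      rw [← Ideal.mem_comap, Ideal.comap_map_of_surjective _ Ideal.Quotient.mk_surjective,
        ← RingHom.ker_eq_comap_bot, Ideal.mk_ker] at h3
      exact h3
    have h4 : Ideal.span {f} ≤ Ideal.span {c n} := by
      rw [Ideal.span_singleton_le_span_singleton]
      exact ⟨t ^ n, by rw [mul_comm]; exact hc n⟩
    rw [sup_eq_left.2 h4, Ideal.mem_span_singleton] at h2
    obtain ⟨e, he⟩ := h2
    have h5 : c n = t * c (n+1) := by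
      have := (hc n).symm.trans (hc (n+1))
      rw [pow_succ, mul_assoc] at this
      exact mul_left_cancel₀ (pow_ne_zero n ht0) this
    have hc0 : c n ≠ 0 := by
      intro h; exact hf0 (by rw [hc n, h, mul_zero])
    apply htnu
    refine IsUnit.of_mul_eq_one e ?_
    have : c n * 1 = c n * (t * e) := by
      rw [mul_one]; nth_rewrite 1 [h5]; rw [he]; ring
    exact (mul_left_cancel₀ hc0 this).symm
  classical
  let k := Nat.find hbound
  have hk : ¬ t ^ k ∣ f := Nat.find_spec hbound
  have hk0 : k ≠ 0 := by
    intro h; rw [h] at hk; simp at hk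
  have hk1 : k ≠ 1 := by
    intro h; rw [h, pow_one] at hk
    rw [ht', Ideal.mem_span_singleton] at hfm
    exact hk hfm
  obtain ⟨u, hu⟩ : t ^ (k-1) ∣ f := by
    have := Nat.find_min hbound (m := k-1) (by omega)
    simpa using this
  refine ⟨W, hW, t, u, k-1, ht', ht0, ?_, by omega, by rw [mul_comm]; exact hu⟩
  by_contra hun
  have : u ∈ maximalIdeal W := hun
  rw [ht', Ideal.mem_span_singleton] at this
  obtain ⟨v, hv⟩ := this
  apply hk
  refine ⟨v, ?_⟩
  rw [hu, hv, ← mul_assoc, ← pow_succ]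
  congr 2; omega

theorem dvr_exists {B K : Type*} [CommRing B] [IsDomain B] [IsNoetherianRing B]
    [Field K] [Algebra B K] [IsFractionRing B K] (a : B) (ha : a ≠ 0) (hu : ¬ IsUnit a) :
    ∃ (W : ValuationSubring K) (hW : ∀ r, algebraMap B K r ∈ W) (t u : W) (k : ℕ),
      maximalIdeal W = Ideal.span {t} ∧ t ≠ 0 ∧ IsUnit u ∧ 1 ≤ k ∧
      (⟨algebraMap B K a, hW a⟩ : W) = u * t ^ k := by
  obtain ⟨P, hP⟩ := (Ideal.span {a}).nonempty_minimalPrimes (by simpa using hu)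
  have hPp : P.IsPrime := hP.1.1
  let R := Localization.AtPrime P
  have hle : P.primeCompl ≤ nonZeroDivisors B := P.primeCompl_le_nonZeroDivisors
  letI : IsDomain R := IsLocalization.isDomain_of_le_nonZeroDivisors _ hle
  letI : Algebra R K := (IsLocalization.lift (M := P.primeCompl) (S := R)
    (g := algebraMap B K) (fun y => by
      rw [isUnit_iff_ne_zero]; simpa using nonZeroDivisors.ne_zero (hle y.2))).toAlgebra
  letI : IsScalarTower B R K := IsScalarTower.of_algebraMap_eq (fun x => by
    simp [RingHom.algebraMap_toAlgebra])
  letI : IsFractionRing R K := IsFractionRing.isFractionRing_of_isDomain_of_isLocalization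
    P.primeCompl R K
  have hnR : IsNoetherianRing R := IsLocalization.isNoetherianRing P.primeCompl R inferInstance
  have hmin : maximalIdeal R ∈ (Ideal.span {algebraMap B R a}).minimalPrimes := by
    have : Ideal.span {algebraMap B R a} = (Ideal.span {a}).map (algebraMap B R) := by
      rw [Ideal.map_span, Set.image_singleton]
    rw [this, IsLocalization.minimalPrimes_map P.primeCompl R,
      Set.mem_preimage, Localization.AtPrime.under_maximalIdeal]
    exact hP
  have ha' : algebraMap B R a ≠ 0 := by
    have := IsLocalization.injective R hle
    exact fun h => ha (this (by rw [h, map_zero]))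
  obtain ⟨W, hW, t, u, k, h1, h2, h3, h4, h5⟩ := dvr_local (K := K) (algebraMap B R a) ha' hmin
  refine ⟨W, fun r => ?_, t, u, k, h1, h2, h3, h4, ?_⟩
  · rw [IsScalarTower.algebraMap_apply B R K]; exact hW _
  · rw [← h5]; apply Subtype.ext
    exact IsScalarTower.algebraMap_apply B R K a

end

section
open IsLocalRing

theorem formallySmooth_charZero (K L : Type*) [Field K] [Field L] [CharZero K] [Algebra K L] :
    Algebra.FormallySmooth K L := by
  obtain ⟨s, hs⟩ := exists_isTranscendenceBasis K L
  have := hs.isAlgebraic_field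
  exact .of_algebraicIndependent_of_isSeparable hs.1

open Polynomial in
theorem exists_derivation_of_section {κ R : Type*} [Field κ] [CommRing R] (g : R →+* κ)
    (σ : κ →+* R) (hσ : ∀ x, g (σ x) = x) (τ : R) (s : ℕ) (hs : 1 ≤ s) (hτs : τ ^ s = 0)
    (hτ0 : g τ = 0) (hτj : ∀ j, j < s → τ ^ j ≠ 0) (hker : ∀ x, g x = 0 → ∃ y, x = τ * y)
    (hunit : ∀ x : R, g x ≠ 0 → IsUnit x) :
    ∃ D : Derivation ℤ R R, D τ = τ ∧ (∀ x, ∃ y, D x = τ * y) ∧ (∀ c, D (σ c) = 0) := by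
  let e : κ[X] →+* R := Polynomial.eval₂RingHom σ τ
  have heC : ∀ a, e (C a) = σ a := fun a => by simp [e]
  have heX : e X = τ := by simp [e]
  have hsurj : Function.Surjective e := by
    have : ∀ m, ∀ x : R, ∃ p y, x = e p + τ ^ m * y := by
      intro m
      induction m with
      | zero => exact fun x => ⟨0, x, by simp⟩
      | succ m ih =>
        intro x
        obtain ⟨p, y, hy⟩ := ih x
        obtain ⟨z, hz⟩ := hker (y - σ (g y)) (by rw [map_sub, hσ, sub_self])
        refine ⟨p + X ^ m * C (g y), z, ?_⟩
        rw [map_add, map_mul, map_pow, heC, heX, hy, pow_succ, mul_assoc, ← hz]; ring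
    intro x
    obtain ⟨p, y, hy⟩ := this s x
    exact ⟨p, by rw [hy, hτs]; simp⟩
  have hge : ∀ p, g (e p) = p.coeff 0 := by
    intro p
    have : p = C (p.coeff 0) + X * p.divX := by rw [add_comm, X_mul_divX_add]
    conv_lhs => rw [this]
    rw [map_add, map_add, map_mul, map_mul, heC, heX, hσ]
    rw [hτ0]; simp
  have hdvd : ∀ p, e p = 0 → X ^ s ∣ p := by
    intro p hp
    have : ∀ j, j ≤ s → X ^ j ∣ p := by
      intro j
      induction j with
      | zero => simp
      | succ j ih =>
        intro hj
        obtain ⟨q, rfl⟩ := ih (by omega)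
        rw [pow_succ]
        refine mul_dvd_mul_left _ ?_
        rw [X_dvd_iff]
        by_contra h0
        have hu := hunit (e q) (by rwa [hge])
        rw [map_mul, map_pow, heX, hu.mul_left_eq_zero] at hp
        exact hτj j (by omega) hp
    exact this s le_rfl
  let d : Derivation ℤ κ[X] κ[X] :=
    Derivation.mk' ((AddMonoidHom.mk' (fun p => X * derivative p)
      (fun p q => by rw [derivative_add, mul_add])).toIntLinearMap)
      (fun p q => by
        simp only [AddMonoidHom.coe_toIntLinearMap, AddMonoidHom.mk'_apply, derivative_mul,
          smul_eq_mul]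
        ring)
  have hd : ∀ p, d p = X * derivative p := fun p => rfl
  have hd0 : ∀ p, e p = 0 → e (d p) = 0 := by
    intro p hp
    obtain ⟨q, rfl⟩ := hdvd p hp
    have : d (X ^ s * q) = X ^ s * ((s : κ[X]) * q + X * derivative q) := by
      rw [hd, derivative_mul, derivative_X_pow]
      obtain ⟨m, rfl⟩ : ∃ m, s = m + 1 := ⟨s - 1, by omega⟩
      simp; ring
    rw [this, map_mul, map_pow, heX, hτs, zero_mul]
  let D := Derivation.liftOfSurjective (f := (e.toIntAlgHom : κ[X] →ₐ[ℤ] R)) hsurj (d := d) hd0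
  have hD : ∀ p, D (e p) = e (d p) := fun p => 
    Derivation.liftOfSurjective_apply (f := (e.toIntAlgHom : κ[X] →ₐ[ℤ] R)) hsurj hd0 p
  refine ⟨D, ?_, ?_, ?_⟩
  · rw [← heX, hD, hd]; simp
  · intro x
    obtain ⟨p, rfl⟩ := hsurj x
    exact ⟨e (derivative p), by rw [hD, hd, map_mul, heX]⟩
  · intro c
    rw [← heC, hD, hd]; simp

theorem exists_derivation_local (K' W : Type*) [Field K'] [CharZero K'] [CommRing W] [IsDomain W]
    [IsLocalRing W] [Algebra K' W] (t : W) (ht : maximalIdeal W = Ideal.span {t}) (ht0 : t ≠ 0)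
    (s : ℕ) (hs : 1 ≤ s) :
    ∃ D : Derivation ℤ (W ⧸ Ideal.span {t ^ s}) (W ⧸ Ideal.span {t ^ s}),
      D (Ideal.Quotient.mk _ t) = Ideal.Quotient.mk _ t ∧
      (∀ x, ∃ y, D x = Ideal.Quotient.mk _ t * y) ∧
      (∀ c : K', D (algebraMap K' _ c) = 0) := by
  have hfs := formallySmooth_charZero K' (ResidueField W)
  let R := W ⧸ Ideal.span {t ^ s}
  have htm : t ∈ maximalIdeal W := by rw [ht]; exact Ideal.mem_span_singleton_self t
  have htnu : ¬ IsUnit t := htm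
  have hle : ∀ a ∈ Ideal.span {t ^ s}, IsScalarTower.toAlgHom K' W (ResidueField W) a = 0 := by
    intro a ha
    rw [Ideal.mem_span_singleton] at ha
    obtain ⟨c, rfl⟩ := ha
    change residue W _ = 0
    rw [residue_eq_zero_iff]
    exact Ideal.mul_mem_right _ _ (Ideal.pow_mem_of_mem _ htm _ hs)
  let g : R →ₐ[K'] ResidueField W :=
    Ideal.Quotient.liftₐ (Ideal.span {t ^ s}) (IsScalarTower.toAlgHom K' W (ResidueField W)) hle
  have hgmk : ∀ w, g (Ideal.Quotient.mk _ w) = residue W w := fun w => rfl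
  set τ : R := Ideal.Quotient.mk _ t with hτ
  have hτs : τ ^ s = 0 := by
    rw [hτ, ← map_pow, Ideal.Quotient.eq_zero_iff_mem]
    exact Ideal.mem_span_singleton_self _
  have hgs : Function.Surjective g := by
    intro x
    obtain ⟨w, rfl⟩ := residue_surjective x
    exact ⟨Ideal.Quotient.mk _ w, rfl⟩
  have hker : ∀ x, g x = 0 → ∃ y, x = τ * y := by
    intro x hx
    obtain ⟨w, rfl⟩ := Ideal.Quotient.mk_surjective x
    rw [hgmk, residue_eq_zero_iff, ht, Ideal.mem_span_singleton] at hx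
    obtain ⟨c, rfl⟩ := hx
    exact ⟨Ideal.Quotient.mk _ c, by rw [map_mul]⟩
  have hnil : IsNilpotent (RingHom.ker (g : R →+* ResidueField W)) := by
    refine ⟨s, ?_⟩
    have : RingHom.ker (g : R →+* ResidueField W) ≤ Ideal.span {τ} := by
      intro x hx
      obtain ⟨y, rfl⟩ := hker x hx
      exact Ideal.mem_span_singleton.2 ⟨y, rfl⟩
    refine le_bot_iff.1 ((Ideal.pow_right_mono this s).trans ?_)
    rw [Ideal.span_singleton_pow, hτs]; simp
  let σ := Algebra.FormallySmooth.liftOfSurjective (AlgHom.id K' (ResidueField W)) g hgs hnil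
  have hσ : ∀ x, g (σ x) = x := fun x =>
    Algebra.FormallySmooth.liftOfSurjective_apply (AlgHom.id K' (ResidueField W)) g hgs hnil x
  have hunit : ∀ x : R, g x ≠ 0 → IsUnit x := by
    intro x hx
    obtain ⟨w, rfl⟩ := Ideal.Quotient.mk_surjective x
    rw [hgmk, Ne, residue_eq_zero_iff] at hx
    have : IsUnit w := not_not.1 hx
    exact this.map _
  have hτj : ∀ j, j < s → τ ^ j ≠ 0 := by
    intro j hj h
    rw [hτ, ← map_pow, Ideal.Quotient.eq_zero_iff_mem, Ideal.mem_span_singleton,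
      pow_dvd_pow_iff ht0 htnu] at h
    omega
  obtain ⟨D, h1, h2, h3⟩ := exists_derivation_of_section (g : R →+* ResidueField W)
    (σ : ResidueField W →+* R) hσ τ s hs hτs
    (by change g τ = 0; rw [hτ, hgmk, residue_eq_zero_iff]; exact htm) hτj hker hunit
  refine ⟨D, h1, h2, fun c => ?_⟩
  have : algebraMap K' R c = σ (algebraMap K' _ c) := by rw [AlgHom.commutes]
  change D (algebraMap K' R c) = 0
  rw [this]; exact h3 _

end

section
open Filter Topology

/-- The monomial `x ^ α`. -/
def mono {n : ℕ} (α : Fin n → ℕ) (x : Fin n → ℝ) : ℝ := ∏ i, x i ^ α i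

/-- `f` is near `0` the sum of the absolutely convergent power series with coefficients `a`. -/
def HasCoef {n : ℕ} (f : (Fin n → ℝ) → ℝ) (a : (Fin n → ℕ) → ℝ) : Prop :=
  ∃ r : ℝ, 0 < r ∧ Summable (fun α => |a α| * r ^ (∑ i, α i)) ∧
    ∀ᶠ x in 𝓝 (0 : Fin n → ℝ), f x = ∑' α, a α * mono α x

theorem mono_abs_le {n : ℕ} (α : Fin n → ℕ) (x : Fin n → ℝ) (r : ℝ) (h : ∀ i, |x i| ≤ r) :
    |mono α x| ≤ r ^ (∑ i, α i) := by
  unfold mono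
  rw [Finset.abs_prod, ← Finset.prod_pow_eq_pow_sum]
  refine Finset.prod_le_prod (fun i _ => abs_nonneg _) (fun i _ => ?_)
  rw [abs_pow]
  exact pow_le_pow_left₀ (abs_nonneg _) (h i) _

theorem mono_add {n : ℕ} (α β : Fin n → ℕ) (x : Fin n → ℝ) :
    mono (α + β) x = mono α x * mono β x := by
  simp [mono, pow_add, Finset.prod_mul_distrib]

theorem exists_multilinear_mono {n : ℕ} (α : Fin n → ℕ) (k : ℕ) (h : ∑ i, α i = k) :
    ∃ M : ContinuousMultilinearMap ℝ (fun _ : Fin k => (Fin n → ℝ)) ℝ,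
      ‖M‖ ≤ 1 ∧ ∀ x, M (fun _ => x) = mono α x := by
  subst h
  refine ⟨(ContinuousMultilinearMap.mkPiAlgebra ℝ (Fin (∑ i, α i)) ℝ).compContinuousLinearMap
    (fun j => ContinuousLinearMap.proj (R := ℝ) (φ := fun _ : Fin n => ℝ)
      (finSigmaFinEquiv.symm j).1), ?_, ?_⟩
  · refine (ContinuousMultilinearMap.norm_compContinuousLinearMap_le _ _).trans ?_
    rw [ContinuousMultilinearMap.norm_mkPiAlgebra, one_mul]
    refine Finset.prod_le_one (fun i _ => norm_nonneg _) (fun i _ => ?_)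
    refine ContinuousLinearMap.opNorm_le_bound _ zero_le_one (fun x => ?_)
    rw [one_mul]; exact norm_le_pi_norm x _
  · intro x
    simp only [ContinuousMultilinearMap.compContinuousLinearMap_apply,
      ContinuousMultilinearMap.mkPiAlgebra_apply, ContinuousLinearMap.proj_apply]
    rw [← finSigmaFinEquiv.prod_comp]
    simp only [Equiv.symm_apply_apply]
    rw [Fintype.prod_sigma]
    simp [mono]

theorem analyticAt_of_summable {n : ℕ} (a : (Fin n → ℕ) → ℝ) (r : ℝ) (hr : 0 < r)
    (ha : Summable (fun α => |a α| * r ^ (∑ i, α i))) :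
    AnalyticAt ℝ (fun x => ∑' α, a α * mono α x) 0 := by
  lift r to NNReal using hr.le
  choose M hM1 hM2 using fun (k : ℕ) (α : Finset.Nat.antidiagonalTuple n k) =>
    exists_multilinear_mono α.1 k (Finset.Nat.mem_antidiagonalTuple.1 α.2)
  let p : FormalMultilinearSeries ℝ (Fin n → ℝ) ℝ := fun k =>
    ∑ α : Finset.Nat.antidiagonalTuple n k, a α.1 • M k α
  let e := Finset.Nat.sigmaAntidiagonalTupleEquivTuple n
  have hdeg : ∀ k (α : Finset.Nat.antidiagonalTuple n k), ∑ i, α.1 i = k := fun k α =>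
    Finset.Nat.mem_antidiagonalTuple.1 α.2
  have hs1 : Summable (fun k => ∑ α : Finset.Nat.antidiagonalTuple n k, |a α.1| * r ^ k) := by
    have h1 := (e.summable_iff.2 ha).sigma
    refine h1.congr (fun k => ?_)
    rw [tsum_fintype]
    refine Finset.sum_congr rfl (fun α _ => ?_)
    have : e ⟨k, α⟩ = α.1 := rfl
    simp only [Function.comp, this, hdeg]
  have hrad : (r : ENNReal) ≤ p.radius := by
    refine p.le_radius_of_summable_norm ?_
    refine Summable.of_nonneg_of_le (fun k => by positivity) (fun k => ?_) hs1
    rw [← Finset.sum_mul]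
    refine mul_le_mul_of_nonneg_right ?_ (by positivity)
    refine (norm_sum_le _ _).trans (Finset.sum_le_sum fun α _ => ?_)
    rw [norm_smul, Real.norm_eq_abs]
    exact mul_le_of_le_one_right (abs_nonneg _) (hM1 k α)
  refine ⟨p, ⟨r, hrad, by simpa using hr, ?_⟩⟩
  intro y hy
  rw [zero_add]
  have hy' : ‖y‖ < r := by
    simpa using hy
  have hsum : Summable (fun α => a α * mono α y) := by
    refine Summable.of_norm_bounded ha (fun α => ?_)
    rw [norm_mul, Real.norm_eq_abs, Real.norm_eq_abs]
    exact mul_le_mul_of_nonneg_left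
      (mono_abs_le _ _ _ fun i => (norm_le_pi_norm y i).trans hy'.le) (abs_nonneg _)
  have h2 := ((e.hasSum_iff.2 hsum.hasSum).sigma (fun k => hasSum_fintype _))
  refine h2.congr_fun ?_
  intro k
  simp only [p, sum_apply, smul_apply, hM2]
  rfl

/-- The exponent of the monomial `∏ j, x (v j)`. -/
def cnt {n : ℕ} (v : Σ k, (Fin k → Fin n)) : Fin n → ℕ :=
  fun i => (Finset.univ.filter (fun j => v.2 j = i)).card

theorem prod_eq_mono_cnt {n : ℕ} (v : Σ k, (Fin k → Fin n)) (x : Fin n → ℝ) :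
    ∏ j, x (v.2 j) = mono (cnt v) x := by
  unfold mono cnt
  rw [← Finset.prod_fiberwise (s := Finset.univ) (g := v.2)]
  refine Finset.prod_congr rfl (fun i _ => ?_)
  rw [Finset.prod_congr rfl (g := fun _ => x i), Finset.prod_const]
  intro j hj
  rw [(Finset.mem_filter.1 hj).2]

theorem sum_cnt {n : ℕ} (v : Σ k, (Fin k → Fin n)) : ∑ i, cnt v i = v.1 := by
  unfold cnt
  rw [← Finset.card_eq_sum_card_fiberwise (fun j _ => Finset.mem_univ _)]
  simp

theorem hasCoef_of_analyticAt {n : ℕ} (f : (Fin n → ℝ) → ℝ) (hf : AnalyticAt ℝ f 0) :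
    ∃ a, HasCoef f a := by
  obtain ⟨p, R, hp⟩ := hf
  obtain ⟨r0, hr0, hr0R⟩ := ENNReal.lt_iff_exists_nnreal_btwn.1 hp.r_pos
  have hr0' : 0 < (r0 : ℝ) := by exact_mod_cast hr0
  obtain ⟨r, hr, hnr⟩ : ∃ r : ℝ, 0 < r ∧ n * r ≤ r0 := by
    refine ⟨r0 / (n + 1), by positivity, ?_⟩
    rw [mul_div_assoc', div_le_iff₀ (by positivity)]
    nlinarith
  let b : (Σ k, (Fin k → Fin n)) → ℝ := fun v => p v.1 (fun j => Pi.single (v.2 j) 1)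
  have hb : ∀ v, |b v| ≤ ‖p v.1‖ := by
    intro v
    refine ((p v.1).le_opNorm _).trans ?_
    refine mul_le_of_le_one_right (norm_nonneg _) ?_
    refine Finset.prod_le_one (fun i _ => norm_nonneg _) (fun i _ => ?_)
    rw [Pi.norm_single]; simp
  have hsum : Summable (fun v : Σ k, (Fin k → Fin n) => |b v| * r ^ v.1) := by
    rw [summable_sigma_of_nonneg (fun v => by positivity)]
    refine ⟨fun k => Summable.of_finite, ?_⟩
    have h0 : Summable (fun k => ‖p k‖ * (r0 : ℝ) ^ k) :=
      p.summable_norm_mul_pow (lt_of_lt_of_le hr0R hp.r_le)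
    refine Summable.of_nonneg_of_le (fun k => by positivity) (fun k => ?_) h0
    rw [tsum_fintype]
    calc ∑ v : Fin k → Fin n, |b ⟨k, v⟩| * r ^ k ≤ ∑ v : Fin k → Fin n, ‖p k‖ * r ^ k :=
          Finset.sum_le_sum fun v _ => mul_le_mul_of_nonneg_right (hb ⟨k, v⟩) (by positivity)
      _ = ‖p k‖ * (n * r) ^ k := by
          rw [Finset.sum_const, Finset.card_univ, Fintype.card_fun, Fintype.card_fin,
            Fintype.card_fin, nsmul_eq_mul, mul_pow]
          push_cast; ring
      _ ≤ _ := by gcongr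
  let e := Equiv.sigmaFiberEquiv (cnt (n := n))
  let a : (Fin n → ℕ) → ℝ := fun α => ∑' v : {v // cnt v = α}, b v.1
  have hsum' := e.summable_iff.2 hsum
  have hfib : ∀ (α : Fin n → ℕ) (v : {v // cnt v = α}), v.1.1 = ∑ i, α i := by
    rintro α ⟨v, rfl⟩; rw [sum_cnt]
  have hsf : ∀ α, Summable (fun v : {v // cnt v = α} => |b v.1|) := by
    intro α
    have := hsum'.sigma_factor α
    have h2 : Summable (fun v : {v // cnt v = α} => |b v.1| * r ^ (∑ i, α i)) := by
      refine this.congr (fun v => ?_)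
      rw [← hfib α v]; rfl
    exact (summable_mul_right_iff (by positivity)).1 h2
  refine ⟨a, r, hr, ?_, ?_⟩
  · refine Summable.of_nonneg_of_le (fun k => by positivity) (fun α => ?_) hsum'.sigma
    have h1 : |a α| ≤ ∑' v : {v // cnt v = α}, |b v.1| := by
      have := norm_tsum_le_tsum_norm (f := fun v : {v // cnt v = α} => b v.1) (hsf α)
      exact this
    have h2 : ∑' v : {v // cnt v = α}, ((fun v => |b v| * r ^ v.1) ∘ e) ⟨α, v⟩ =
        (∑' v : {v // cnt v = α}, |b v.1|) * r ^ (∑ i, α i) := by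
      rw [← tsum_mul_right]
      refine tsum_congr (fun v => ?_)
      rw [← hfib α v]; rfl
    rw [h2]
    exact mul_le_mul_of_nonneg_right h1 (by positivity)
  · have hball : ∀ᶠ x in 𝓝 (0 : Fin n → ℝ), x ∈ Metric.eball (0 : Fin n → ℝ) R :=
      Metric.eball_mem_nhds _ hp.r_pos
    have hball2 : ∀ᶠ x in 𝓝 (0 : Fin n → ℝ), ‖x‖ ≤ r := by
      filter_upwards [Metric.closedBall_mem_nhds (0 : Fin n → ℝ) hr] with x hx
      simpa using hx
    filter_upwards [hball, hball2] with x hx hxr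
    have h1 := hp.hasSum hx
    rw [zero_add] at h1
    have hS : Summable (fun v => b v * mono (cnt v) x) := by
      refine Summable.of_norm_bounded hsum (fun v => ?_)
      rw [norm_mul, Real.norm_eq_abs, Real.norm_eq_abs]
      refine mul_le_mul_of_nonneg_left ?_ (abs_nonneg _)
      have := mono_abs_le (cnt v) x r fun i => (norm_le_pi_norm x i).trans hxr
      rwa [sum_cnt] at this
    have h2 : ∀ k, p k (fun _ => x) = ∑ v : Fin k → Fin n, b ⟨k, v⟩ * mono (cnt ⟨k, v⟩) x := by
      intro k
      have hx' : x = ∑ i, x i • (Pi.single i 1 : Fin n → ℝ) := by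
        ext j; simp [Finset.sum_apply, Pi.single_apply]
      conv_lhs => rw [hx']
      rw [ContinuousMultilinearMap.map_sum]
      refine Finset.sum_congr rfl (fun v _ => ?_)
      rw [ContinuousMultilinearMap.map_smul_univ, smul_eq_mul, mul_comm, ← prod_eq_mono_cnt]
    have h3 : f x = ∑' v, b v * mono (cnt v) x := by
      rw [hS.tsum_sigma, ← h1.tsum_eq]
      refine tsum_congr (fun k => ?_)
      rw [tsum_fintype, h2]
    rw [h3, ← e.tsum_eq]
    refine ((e.summable_iff.2 hS).tsum_sigma).trans ?_
    refine tsum_congr (fun α => ?_)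
    rw [← tsum_mul_right]
    refine tsum_congr (fun v => ?_)
    obtain ⟨v, rfl⟩ := v
    rfl

end

section
open Filter Topology

/-- Absolutely summable families. -/
abbrev L1 (ι : Type) := lp (fun _ : ι => ℝ) 1

theorem L1.summable {ι : Type} (b : L1 ι) : Summable (fun α => |b α|) := by
  have := (lp.memℓp b).summable (by simp)
  simpa using this

theorem L1.norm_eq {ι : Type} (b : L1 ι) : ‖b‖ = ∑' α, |b α| := by
  have := lp.norm_eq_tsum_rpow (p := 1) (by simp) b
  simpa using this

/-- Build an element of `L1`. -/
def L1.mk {ι : Type} (f : ι → ℝ) (hf : Summable (fun α => |f α|)) : L1 ι :=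
  ⟨f, memℓp_gen (by simpa using hf)⟩

theorem L1.mk_apply {ι : Type} (f : ι → ℝ) (hf : Summable (fun α => |f α|)) (α : ι) :
    L1.mk f hf α = f α := rfl

theorem L1.summable_smul {ι : Type} {F : Type} [NormedAddCommGroup F] [NormedSpace ℝ F]
    [CompleteSpace F] (v : ι → F) (C : ℝ) (hv : ∀ α, ‖v α‖ ≤ C) (b : L1 ι) :
    Summable (fun α => b α • v α) := by
  refine Summable.of_norm_bounded ((L1.summable b).mul_right C) (fun α => ?_)
  rw [norm_smul]
  exact mul_le_mul_of_nonneg_left (hv α) (norm_nonneg _)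

/-- The universal property of `L1`. -/
noncomputable def L1.lift {ι : Type} {F : Type} [NormedAddCommGroup F] [NormedSpace ℝ F]
    [CompleteSpace F] (v : ι → F) (C : ℝ) (hv : ∀ α, ‖v α‖ ≤ C) : L1 ι →L[ℝ] F :=
  LinearMap.mkContinuous
    { toFun := fun b => ∑' α, b α • v α
      map_add' := fun b b' => by
        rw [← (L1.summable_smul v C hv b).tsum_add (L1.summable_smul v C hv b')]
        refine tsum_congr fun α => ?_
        rw [← add_smul]; rfl
      map_smul' := fun c b => by
        rw [RingHom.id_apply, ← (L1.summable_smul v C hv b).tsum_const_smul c]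
        refine tsum_congr fun α => ?_
        rw [smul_smul]; rfl } C (fun b => by
      change ‖∑' α, b α • v α‖ ≤ _
      rw [L1.norm_eq, mul_comm, ← tsum_mul_right]
      refine tsum_of_norm_bounded ((L1.summable b).mul_right C).hasSum (fun α => ?_)
      rw [norm_smul]
      exact mul_le_mul_of_nonneg_left (hv α) (norm_nonneg _))

theorem L1.lift_apply {ι : Type} {F : Type} [NormedAddCommGroup F] [NormedSpace ℝ F]
    [CompleteSpace F] (v : ι → F) (C : ℝ) (hv : ∀ α, ‖v α‖ ≤ C) (b : L1 ι) :
    L1.lift v C hv b = ∑' α, b α • v α := rfl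

theorem L1.norm_lift_le {ι : Type} {F : Type} [NormedAddCommGroup F] [NormedSpace ℝ F]
    [CompleteSpace F] (v : ι → F) (C : ℝ) (hC : 0 ≤ C) (hv : ∀ α, ‖v α‖ ≤ C) :
    ‖L1.lift v C hv‖ ≤ C := LinearMap.mkContinuous_norm_le _ hC _

theorem L1.map_lift {ι : Type} {F G : Type} [NormedAddCommGroup F] [NormedSpace ℝ F]
    [CompleteSpace F] [NormedAddCommGroup G] [NormedSpace ℝ G]
    (v : ι → F) (C : ℝ) (hv : ∀ α, ‖v α‖ ≤ C) (b : L1 ι)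
    (φ : F →L[ℝ] G) : φ (L1.lift v C hv b) = ∑' α, b α • φ (v α) := by
  rw [L1.lift_apply, φ.map_tsum (L1.summable_smul v C hv b)]
  simp

theorem l1_division {ι : Type} [DecidableEq ι] (d : ι → L1 ι) (hd : ∀ β, ‖d β‖ ≤ 1 / 2)
    (a : L1 ι) : ∃ b : L1 ι, ∀ φ : L1 ι →L[ℝ] ℝ,
      φ a = ∑' β, b β * (φ (lp.single 1 β 1) + φ (d β)) := by
  let T : L1 ι →L[ℝ] L1 ι := L1.lift d (1/2) hd
  have hT : ‖-T‖ < 1 := by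
    rw [norm_neg]
    exact (L1.norm_lift_le d (1/2) (by norm_num) hd).trans_lt (by norm_num)
  have hu : IsUnit (1 - (-T)) := isUnit_one_sub_of_norm_lt_one hT
  obtain ⟨u, hu⟩ := hu
  refine ⟨(↑u⁻¹ : L1 ι →L[ℝ] L1 ι) a, fun φ => ?_⟩
  set b := (↑u⁻¹ : L1 ι →L[ℝ] L1 ι) a with hb
  have hab : a = b + T b := by
    have : (u : L1 ι →L[ℝ] L1 ι) b = a := by
      rw [hb, ← mul_apply_eq_comp, Units.mul_inv]; rfl
    rw [hu] at this
    rw [← this]; simp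
  have hbs : L1.lift (fun β => (lp.single 1 β 1 : L1 ι)) 1 (fun β => by
      rw [lp.norm_single (by norm_num)]; simp) b = b := by
    rw [L1.lift_apply]
    have := lp.hasSum_single (p := 1) (by simp) b
    rw [← this.tsum_eq]
    refine tsum_congr fun α => ?_
    rw [this.tsum_eq, ← lp.single_smul]; simp
  have hs1 := L1.summable_smul (fun β => φ (lp.single 1 β 1 : L1 ι)) ‖φ‖ (fun β => by
    refine (φ.le_opNorm _).trans ?_
    rw [lp.norm_single (by norm_num)]; simp) b
  have hs2 := L1.summable_smul (fun β => φ (d β)) (‖φ‖ * (1/2)) (fun β => by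
    refine (φ.le_opNorm _).trans ?_
    exact mul_le_mul_of_nonneg_left (hd β) (norm_nonneg _)) b
  rw [hab, map_add, L1.map_lift]
  conv_lhs => rw [← hbs]
  rw [L1.map_lift, hbs, ← hs1.tsum_add hs2]
  refine tsum_congr fun β => ?_
  simp only [smul_eq_mul]; ring

theorem mono_pow_inv {n : ℕ} (α : Fin n → ℕ) (B : Fin n → ℝ) (σ : ℕ) :
    mono α (fun i => (B i)⁻¹ ^ σ) = (mono α B)⁻¹ ^ σ := by
  unfold mono
  rw [← Finset.prod_inv_distrib, ← Finset.prod_pow]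
  refine Finset.prod_congr rfl fun i _ => ?_
  rw [← pow_mul, ← inv_pow, ← pow_mul, mul_comm]

theorem mono_pos {n : ℕ} (α : Fin n → ℕ) (B : Fin n → ℝ) (hB : ∀ i, 0 < B i) : 0 < mono α B :=
  Finset.prod_pos fun i _ => pow_pos (hB i) _

theorem mono_le_mono {n : ℕ} (α : Fin n → ℕ) (x y : Fin n → ℝ) (h0 : ∀ i, 0 ≤ x i)
    (h : ∀ i, x i ≤ y i) : mono α x ≤ mono α y :=
  Finset.prod_le_prod (fun i _ => pow_nonneg (h0 i) _)
    (fun i _ => pow_le_pow_left₀ (h0 i) (h i) _)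

theorem mono_const {n : ℕ} (α : Fin n → ℕ) (r : ℝ) : mono α (fun _ => r) = r ^ (∑ i, α i) := by
  unfold mono; rw [Finset.prod_pow_eq_pow_sum]

theorem eventually_small {n : ℕ} (B : Fin n → ℝ) (hB : ∀ i, 2 ≤ B i) (r : ℝ) (hr : 0 < r) :
    ∀ᶠ σ : ℕ in atTop, ∀ i, (B i)⁻¹ ^ σ ≤ r := by
  rw [eventually_all]
  intro i
  have : Tendsto (fun σ : ℕ => (B i)⁻¹ ^ σ) atTop (𝓝 0) := by
    apply tendsto_pow_atTop_nhds_zero_of_lt_one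
    · have := hB i; positivity
    · exact inv_lt_one_of_one_lt₀ (by linarith [hB i])
  exact this.eventually (Iic_mem_nhds hr)

theorem eventually_dominant {n : ℕ} (B : Fin n → ℝ) (hB : ∀ i, 2 ≤ B i)
    (c : (Fin n → ℕ) → ℝ) (r : ℝ) (hr : 0 < r)
    (hc : Summable (fun α => |c α| * r ^ (∑ i, α i))) (τ : Fin n → ℕ)
    (hτ : ∀ δ, δ ≠ τ → c δ ≠ 0 → mono τ B < mono δ B) :
    ∀ᶠ σ : ℕ in atTop, Summable (fun δ => |if δ = τ then 0 else
        c δ * mono δ (fun i => (B i)⁻¹ ^ σ) / mono τ (fun i => (B i)⁻¹ ^ σ)|) ∧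
      ∑' δ, |if δ = τ then 0 else
        c δ * mono δ (fun i => (B i)⁻¹ ^ σ) / mono τ (fun i => (B i)⁻¹ ^ σ)| ≤ 1 / 2 := by
  have hBp : ∀ i, 0 < B i := fun i => by linarith [hB i]
  obtain ⟨σ₁, hσ₁⟩ := (eventually_small B hB r hr).exists
  set bd : (Fin n → ℕ) → ℝ := fun δ => |c δ| * r ^ (∑ i, δ i) * (mono τ B) ^ σ₁ with hbd
  have hbs : Summable bd := hc.mul_right _
  have hform : ∀ σ δ, |if δ = τ then 0 else
        c δ * mono δ (fun i => (B i)⁻¹ ^ σ) / mono τ (fun i => (B i)⁻¹ ^ σ)| =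
        if δ = τ then 0 else |c δ| * (mono τ B / mono δ B) ^ σ := by
    intro σ δ
    split_ifs with h
    · simp
    · have h1 := mono_pos δ B hBp
      have h2 := mono_pos τ B hBp
      rw [mono_pow_inv, mono_pow_inv, abs_div, abs_mul, abs_of_pos (by positivity : 0 < (mono δ B)⁻¹ ^ σ),
        abs_of_pos (by positivity : 0 < (mono τ B)⁻¹ ^ σ), div_pow, inv_pow, inv_pow]
      field_simp
  have hle : ∀ σ, σ₁ ≤ σ → ∀ δ, ‖(if δ = τ then 0 else |c δ| * (mono τ B / mono δ B) ^ σ)‖ ≤ bd δ := by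
    intro σ hσ δ
    have h1 := mono_pos δ B hBp
    have h2 := mono_pos τ B hBp
    split_ifs with h
    · simp only [hbd, norm_zero]; positivity
    · by_cases h0 : c δ = 0
      · simp [h0, hbd]
      have h3 := hτ δ h h0
      have h4 : (mono τ B / mono δ B) ^ σ ≤ (mono τ B / mono δ B) ^ σ₁ :=
        pow_le_pow_of_le_one (by positivity) ((div_le_one h1).2 h3.le) hσ
      have h5 : (mono δ B)⁻¹ ^ σ₁ ≤ r ^ (∑ i, δ i) := by
        rw [← mono_pow_inv, ← mono_const]
        exact mono_le_mono _ _ _ (fun i => by have := hBp i; positivity) hσ₁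
      rw [Real.norm_of_nonneg (by positivity), hbd]
      simp only []
      rw [mul_assoc]
      refine mul_le_mul_of_nonneg_left (h4.trans ?_) (abs_nonneg _)
      rw [div_eq_mul_inv, mul_pow, mul_comm]
      exact mul_le_mul_of_nonneg_right h5 (by positivity)
  have htend := tendsto_tsum_of_dominated_convergence (𝓕 := atTop)
    (f := fun (σ : ℕ) δ => (if δ = τ then 0 else |c δ| * (mono τ B / mono δ B) ^ σ))
    (g := fun _ => (0:ℝ)) hbs (fun δ => by
      by_cases h : δ = τ
      · simp [h]
      by_cases h0 : c δ = 0
      · simp [h0]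
      simp only [h, if_false]
      have h1 := mono_pos δ B hBp
      have h2 := mono_pos τ B hBp
      have := (tendsto_pow_atTop_nhds_zero_of_lt_one (r := mono τ B / mono δ B) (by positivity)
        ((div_lt_one h1).2 (hτ δ h h0))).const_mul |c δ|
      simpa using this)
    (by filter_upwards [eventually_ge_atTop σ₁] with σ hσ using hle σ hσ)
  rw [tsum_zero] at htend
  filter_upwards [eventually_ge_atTop σ₁, htend.eventually (Iic_mem_nhds (by norm_num : (0:ℝ) < 1/2))]
    with σ hσ h2
  simp only [hform]
  exact ⟨Summable.of_norm_bounded hbs (hle σ hσ), h2⟩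

end

section
open Filter Topology

theorem HasCoef.analyticAt {n : ℕ} {f : (Fin n → ℝ) → ℝ} {a : (Fin n → ℕ) → ℝ}
    (h : HasCoef f a) : AnalyticAt ℝ f 0 := by
  obtain ⟨r, hr, hs, he⟩ := h
  exact (analyticAt_of_summable a r hr hs).congr (he.mono fun x hx => hx.symm)

theorem hasCoef_mk {n : ℕ} (a : (Fin n → ℕ) → ℝ) (r : ℝ) (hr : 0 < r)
    (ha : Summable (fun α => |a α| * r ^ (∑ i, α i))) :
    HasCoef (fun x => ∑' α, a α * mono α x) a :=
  ⟨r, hr, ha, Eventually.of_forall fun _ => rfl⟩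

theorem analytic_division {n : ℕ} (B : Fin n → ℝ) (hB : ∀ i, 2 ≤ B i)
    (T : Finset (Fin n → ℕ)) (g : (Fin n → ℕ) → (Fin n → ℝ) → ℝ)
    (cg : (Fin n → ℕ) → (Fin n → ℕ) → ℝ)
    (hg : ∀ τ ∈ T, HasCoef (g τ) (cg τ)) (hg1 : ∀ τ ∈ T, cg τ τ = 1)
    (hg2 : ∀ τ ∈ T, ∀ δ, δ ≠ τ → cg τ δ ≠ 0 → mono τ B < mono δ B)
    (f : (Fin n → ℝ) → ℝ) (hf : AnalyticAt ℝ f 0) :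
    ∃ (q : (Fin n → ℕ) → (Fin n → ℝ) → ℝ) (c : (Fin n → ℕ) → ℝ) (r : (Fin n → ℝ) → ℝ),
      (∀ τ, AnalyticAt ℝ (q τ) 0) ∧ HasCoef r c ∧ (∀ β, (∃ τ ∈ T, τ ≤ β) → c β = 0) ∧
      ∀ᶠ x in 𝓝 (0 : Fin n → ℝ), f x = ∑ τ ∈ T, q τ x * g τ x + r x := by
  classical
  have hBp : ∀ i, 0 < B i := fun i => by linarith [hB i]
  obtain ⟨a, ra, hra, hsa, hea⟩ := hasCoef_of_analyticAt f hf
  choose! rg hrg hsg heg using hg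
  -- choose the polyradius
  obtain ⟨σ, hσ1, hσ2, hσ3⟩ : ∃ σ : ℕ, (∀ i, (B i)⁻¹ ^ σ ≤ ra) ∧
      (∀ τ ∈ T, ∀ i, (B i)⁻¹ ^ σ ≤ rg τ) ∧
      (∀ τ ∈ T, Summable (fun δ => |if δ = τ then 0 else
        cg τ δ * mono δ (fun i => (B i)⁻¹ ^ σ) / mono τ (fun i => (B i)⁻¹ ^ σ)|) ∧
      ∑' δ, |if δ = τ then 0 else
        cg τ δ * mono δ (fun i => (B i)⁻¹ ^ σ) / mono τ (fun i => (B i)⁻¹ ^ σ)| ≤ 1 / 2) := by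
    refine Eventually.exists (f := atTop) ?_
    refine (eventually_small B hB ra hra).and (Eventually.and ?_ ?_)
    · rw [eventually_all_finset]
      exact fun τ hτ => eventually_small B hB _ (hrg τ hτ)
    · rw [eventually_all_finset]
      exact fun τ hτ => eventually_dominant B hB _ _ (hrg τ hτ) (hsg τ hτ) τ (hg2 τ hτ)
  set ρ : Fin n → ℝ := fun i => (B i)⁻¹ ^ σ with hρ
  have hρ0 : ∀ i, 0 < ρ i := fun i => by have := hBp i; simp only [hρ]; positivity
  have hw : ∀ α, 0 < mono α ρ := fun α => mono_pos α ρ hρ0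
  -- a uniform radius below all `ρ i`
  obtain ⟨r0, hr0, hr0ρ⟩ : ∃ r0 : ℝ, 0 < r0 ∧ ∀ i, r0 ≤ ρ i := by
    have : ∀ᶠ r0 in 𝓝[>] (0:ℝ), ∀ i, r0 ≤ ρ i := by
      rw [eventually_all]
      exact fun i => nhdsWithin_le_nhds (Iic_mem_nhds (hρ0 i))
    obtain ⟨r0, h1, h2⟩ := (this.and self_mem_nhdsWithin).exists
    exact ⟨r0, h2, h1⟩
  have hr0w : ∀ α : Fin n → ℕ, r0 ^ (∑ i, α i) ≤ mono α ρ := fun α => by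
    rw [← mono_const]; exact mono_le_mono _ _ _ (fun _ => hr0.le) hr0ρ
  have hmono : ∀ α x, (∀ i, |x i| ≤ ρ i) → ‖mono α x / mono α ρ‖ ≤ 1 := by
    intro α x hx
    rw [norm_div, Real.norm_of_nonneg (hw α).le, div_le_one (hw α)]
    unfold mono
    rw [Real.norm_eq_abs, Finset.abs_prod]
    refine Finset.prod_le_prod (fun i _ => abs_nonneg _) (fun i _ => ?_)
    rw [abs_pow]
    exact pow_le_pow_left₀ (abs_nonneg _) (hx i) _
  -- the selection
  let s : (Fin n → ℕ) → Option (Fin n → ℕ) := fun β =>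
    if h : ∃ τ ∈ T, τ ≤ β then some h.choose else none
  have hs_some : ∀ β τ, s β = some τ → τ ∈ T ∧ τ ≤ β := by
    intro β τ h
    by_cases hh : ∃ τ ∈ T, τ ≤ β
    · simp only [s, dif_pos hh, Option.some.injEq] at h
      rw [← h]; exact hh.choose_spec
    · simp only [s, dif_neg hh] at h; cases h
  have hs_none : ∀ β, (∃ τ ∈ T, τ ≤ β) → s β ≠ none := by
    intro β h; simp only [s, dif_pos h]; simp
  let A : L1 (Fin n → ℕ) := L1.mk (fun α => a α * mono α ρ) (by
    refine Summable.of_nonneg_of_le (fun α => abs_nonneg _) (fun α => ?_) hsa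
    rw [abs_mul, abs_of_pos (hw α)]
    refine mul_le_mul_of_nonneg_left ?_ (abs_nonneg _)
    rw [← mono_const]
    exact mono_le_mono _ _ _ (fun i => (hρ0 i).le) hσ1)
  let Δ : (Fin n → ℕ) → L1 (Fin n → ℕ) := fun τ => if h : τ ∈ T then L1.mk _ (hσ3 τ h).1 else 0
  have hΔ : ∀ τ, ‖Δ τ‖ ≤ 1 / 2 := by
    intro τ
    by_cases h : τ ∈ T
    · simp only [Δ, dif_pos h]; rw [L1.norm_eq]; exact (hσ3 τ h).2
    · simp only [Δ, dif_neg h, norm_zero]; norm_num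
  have hsing : ∀ (γ β : Fin n → ℕ), ‖(lp.single 1 (β + γ) 1 : L1 (Fin n → ℕ))‖ ≤ 1 := by
    intro γ β; rw [lp.norm_single (by norm_num)]; simp
  let d : (Fin n → ℕ) → L1 (Fin n → ℕ) := fun β =>
    (s β).elim 0 (fun τ => L1.lift (fun δ => (lp.single 1 (δ + (β - τ)) 1 : L1 (Fin n → ℕ))) 1
      (hsing _) (Δ τ))
  have hd : ∀ β, ‖d β‖ ≤ 1 / 2 := by
    intro β
    cases h : s β with
    | none => simp only [d, h, Option.elim, norm_zero]; norm_num
    | some τ =>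
      simp only [d, h, Option.elim]
      refine (ContinuousLinearMap.le_opNorm _ _).trans ?_
      have h1 := L1.norm_lift_le _ 1 zero_le_one (hsing (β - τ))
      calc _ ≤ 1 * ‖Δ τ‖ := mul_le_mul_of_nonneg_right h1 (norm_nonneg _)
        _ ≤ _ := by rw [one_mul]; exact hΔ τ
  obtain ⟨b, hb⟩ := l1_division d hd A
  -- quotients and remainder
  let cq : (Fin n → ℕ) → (Fin n → ℕ) → ℝ := fun τ δ =>
    if s (δ + τ) = some τ then b (δ + τ) / mono (δ + τ) ρ else 0
  let cr : (Fin n → ℕ) → ℝ := fun β => if s β = none then b β / mono β ρ else 0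
  have hcq : ∀ τ, Summable (fun δ => |cq τ δ| * r0 ^ (∑ i, δ i)) := by
    intro τ
    have h1 : Summable (fun δ => |b (δ + τ)| * (mono τ ρ)⁻¹) :=
      ((L1.summable b).comp_injective (add_left_injective τ)).mul_right _
    refine Summable.of_nonneg_of_le (fun α => by positivity) (fun δ => ?_) h1
    simp only [cq]
    have := hw τ
    split_ifs
    · rw [mono_add, abs_div, abs_of_pos (mul_pos (hw δ) (hw τ))]
      have h3 := hw δ
      calc |b (δ + τ)| / (mono δ ρ * mono τ ρ) * r0 ^ (∑ i, δ i)
          ≤ |b (δ + τ)| / (mono δ ρ * mono τ ρ) * mono δ ρ :=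
            mul_le_mul_of_nonneg_left (hr0w δ) (by positivity)
        _ = _ := by field_simp
    · rw [abs_zero, zero_mul]; positivity
  have hcr : Summable (fun δ => |cr δ| * r0 ^ (∑ i, δ i)) := by
    refine Summable.of_nonneg_of_le (fun α => by positivity) (fun δ => ?_) (L1.summable b)
    simp only [cr]
    have h3 := hw δ
    split_ifs
    · rw [abs_div, abs_of_pos h3]
      calc |b δ| / (mono δ ρ) * r0 ^ (∑ i, δ i) ≤ |b δ| / (mono δ ρ) * mono δ ρ :=
            mul_le_mul_of_nonneg_left (hr0w δ) (by positivity)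
        _ = _ := by field_simp
    · rw [abs_zero, zero_mul]; positivity
  refine ⟨fun τ x => ∑' α, cq τ α * mono α x, cr, fun x => ∑' α, cr α * mono α x,
    fun τ => analyticAt_of_summable _ r0 hr0 (hcq τ), hasCoef_mk _ r0 hr0 hcr, ?_, ?_⟩
  · intro β hβ; simp only [cr, if_neg (hs_none β hβ)]
  have hx0 : ∀ᶠ x in 𝓝 (0 : Fin n → ℝ), ‖x‖ ≤ r0 := by
    filter_upwards [Metric.closedBall_mem_nhds (0 : Fin n → ℝ) hr0] with x hx
    simpa using hx
  have heg' : ∀ᶠ x in 𝓝 (0 : Fin n → ℝ), ∀ τ ∈ T, g τ x = ∑' α, cg τ α * mono α x := by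
    rw [eventually_all_finset]; exact heg
  filter_upwards [hea, heg', hx0] with x hfx hgx hxr
  have hxρ : ∀ i, |x i| ≤ ρ i := fun i => ((norm_le_pi_norm x i).trans hxr).trans (hr0ρ i)
  let φ : L1 (Fin n → ℕ) →L[ℝ] ℝ :=
    L1.lift (fun α => mono α x / mono α ρ) 1 (fun α => hmono α x hxρ)
  have hφs : ∀ β, φ (lp.single 1 β 1) = mono β x / mono β ρ := by
    intro β
    simp only [φ]
    rw [L1.lift_apply, tsum_eq_single β]
    · rw [lp.single_apply_self, one_smul]
    · intro β' h; rw [lp.single_apply_ne _ _ _ h, zero_smul]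
  have hφA : φ A = f x := by
    simp only [φ]
    rw [L1.lift_apply, hfx]
    refine tsum_congr fun α => ?_
    have := (hw α).ne'
    simp only [A, L1.mk_apply, smul_eq_mul]
    field_simp
  have hφd : ∀ β τ, s β = some τ → φ (lp.single 1 β 1) + φ (d β) =
      mono (β - τ) x * g τ x / mono β ρ := by
    intro β τ h
    obtain ⟨hτT, hτβ⟩ := hs_some β τ h
    have hβ : (β - τ) + τ = β := tsub_add_cancel_of_le hτβ
    have hwβ : mono β ρ = mono (β - τ) ρ * mono τ ρ := by rw [← mono_add, hβ]
    have hxβ : mono β x = mono (β - τ) x * mono τ x := by rw [← mono_add, hβ]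
    have hgs : Summable (fun δ => cg τ δ * mono δ x) := by
      refine Summable.of_norm_bounded (hsg τ hτT) (fun δ => ?_)
      rw [norm_mul, Real.norm_eq_abs, Real.norm_eq_abs]
      exact mul_le_mul_of_nonneg_left
        (mono_abs_le _ _ _ fun i => (hxρ i).trans (hσ2 τ hτT i)) (abs_nonneg _)
    have h1 : φ (d β) = ∑' δ, (mono (β - τ) x / mono β ρ) *
        (if δ = τ then 0 else cg τ δ * mono δ x) := by
      simp only [d, h, Option.elim]
      rw [L1.map_lift]
      refine tsum_congr fun δ => ?_
      rw [hφs, mono_add, mono_add, hwβ]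
      simp only [Δ, dif_pos hτT, L1.mk_apply, smul_eq_mul]
      have h2 := (hw δ).ne'
      have h3 := (hw τ).ne'
      have h4 := (hw (β - τ)).ne'
      split_ifs
      · simp
      · field_simp
    rw [h1, tsum_mul_left, hφs, hgx τ hτT, hgs.tsum_eq_add_tsum_ite τ, hg1 τ hτT, hxβ]
    ring
  have hφn : ∀ β, s β = none → φ (lp.single 1 β 1) + φ (d β) = mono β x / mono β ρ := by
    intro β h
    rw [hφs]; simp [d, h]
  rw [← hφA, hb φ]
  have key : ∀ β, b β * (φ (lp.single 1 β 1) + φ (d β)) =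
      ∑ τ ∈ T, (if s β = some τ then b β / mono β ρ * mono (β - τ) x else 0) * g τ x
        + cr β * mono β x := by
    intro β
    cases h : s β with
    | none => rw [hφn β h]; simp [cr, h]; ring
    | some τ =>
      rw [hφd β τ h, Finset.sum_eq_single τ]
      · simp [cr, h]; ring
      · intro τ' _ hne
        have : ¬ (some τ = some τ') := fun h => hne (Option.some.inj h).symm
        rw [if_neg this, zero_mul]
      · intro hn; exact absurd (hs_some β τ h).1 hn
  have hxmono : ∀ α, |mono α x| ≤ mono α ρ := by
    intro α
    have := hmono α x hxρ
    rwa [norm_div, Real.norm_of_nonneg (hw α).le, div_le_one (hw α)] at this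
  have hsumr : Summable (fun β => cr β * mono β x) := by
    refine Summable.of_norm_bounded hcr (fun δ => ?_)
    rw [norm_mul, Real.norm_eq_abs, Real.norm_eq_abs]
    exact mul_le_mul_of_nonneg_left
      (mono_abs_le _ _ _ fun i => (norm_le_pi_norm x i).trans hxr) (abs_nonneg _)
  have hsumq' : ∀ τ, Summable (fun β => cq τ β * mono β x) := by
    intro τ
    refine Summable.of_norm_bounded (hcq τ) (fun δ => ?_)
    rw [norm_mul, Real.norm_eq_abs, Real.norm_eq_abs]
    exact mul_le_mul_of_nonneg_left
      (mono_abs_le _ _ _ fun i => (norm_le_pi_norm x i).trans hxr) (abs_nonneg _)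
  let F : (Fin n → ℕ) → (Fin n → ℕ) → ℝ := fun τ β =>
    if s β = some τ then b β / mono β ρ * mono (β - τ) x else 0
  have hFsupp : ∀ τ, Function.support (F τ) ⊆ Set.range (fun δ => δ + τ) := by
    intro τ β hβ
    by_cases h : s β = some τ
    · exact ⟨β - τ, tsub_add_cancel_of_le (hs_some β τ h).2⟩
    · exact absurd (by simp [F, h]) hβ
  have hFcq : ∀ τ δ, F τ (δ + τ) = cq τ δ * mono δ x := by
    intro τ δ
    simp only [F, cq, add_tsub_cancel_right]
    split_ifs <;> simp
  have hsumF : ∀ τ, Summable (F τ) := by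
    intro τ
    have h1 : Summable (F τ ∘ fun δ => δ + τ) := (hsumq' τ).congr (fun δ => (hFcq τ δ).symm)
    exact ((add_left_injective τ).summable_iff (fun β hβ => by
      by_contra h; exact hβ (hFsupp τ h))).1 h1
  have htsF : ∀ τ, ∑' β, F τ β = ∑' δ, cq τ δ * mono δ x := by
    intro τ
    rw [← (add_left_injective τ).tsum_eq (hFsupp τ)]
    exact tsum_congr (hFcq τ)
  calc ∑' β, b β * (φ (lp.single 1 β 1) + φ (d β))
      = ∑' β, (∑ τ ∈ T, F τ β * g τ x + cr β * mono β x) := tsum_congr key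
    _ = ∑' β, ∑ τ ∈ T, F τ β * g τ x + ∑' β, cr β * mono β x :=
        Summable.tsum_add (summable_sum fun τ _ => (hsumF τ).mul_right _) hsumr
    _ = _ := by
      congr 1
      rw [Summable.tsum_finsetSum (fun τ _ => (hsumF τ).mul_right _)]
      refine Finset.sum_congr rfl fun τ _ => ?_
      rw [tsum_mul_right, htsF]

end

section
open Filter Topology

/-- The ring of germs at `0` of real analytic functions on `ℝⁿ`. -/
def An (n : ℕ) : Subring (Germ (𝓝 (0 : Fin n → ℝ)) ℝ) where
  carrier := {φ | ∃ f : (Fin n → ℝ) → ℝ, AnalyticAt ℝ f 0 ∧ φ = (f : Germ (𝓝 (0 : Fin n → ℝ)) ℝ)}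
  mul_mem' := by
    rintro _ _ ⟨f, hf, rfl⟩ ⟨g, hg, rfl⟩
    exact ⟨f * g, hf.mul hg, rfl⟩
  one_mem' := ⟨1, analyticAt_const, rfl⟩
  add_mem' := by
    rintro _ _ ⟨f, hf, rfl⟩ ⟨g, hg, rfl⟩
    exact ⟨f + g, hf.add hg, rfl⟩
  zero_mem' := ⟨0, analyticAt_const, rfl⟩
  neg_mem' := by
    rintro _ ⟨f, hf, rfl⟩
    exact ⟨-f, hf.neg, rfl⟩

namespace An

variable {n : ℕ}

/-- The germ of an analytic function. -/
def mk (f : (Fin n → ℝ) → ℝ) (hf : AnalyticAt ℝ f 0) : An n := ⟨f, f, hf, rfl⟩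

theorem mk_surj (φ : An n) : ∃ f hf, φ = mk f hf := by
  obtain ⟨_, f, hf, rfl⟩ := φ
  exact ⟨f, hf, rfl⟩

theorem mk_eq_iff {f g : (Fin n → ℝ) → ℝ} {hf : AnalyticAt ℝ f 0} {hg : AnalyticAt ℝ g 0} :
    mk f hf = mk g hg ↔ ∀ᶠ x in 𝓝 0, f x = g x := by
  have h1 : mk f hf = mk g hg ↔ (mk f hf).1 = (mk g hg).1 := Subtype.ext_iff
  rw [h1]
  exact Germ.coe_eq

theorem mk_add {f g : (Fin n → ℝ) → ℝ} (hf : AnalyticAt ℝ f 0) (hg : AnalyticAt ℝ g 0) :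
    mk (fun x => f x + g x) (hf.add hg) = mk f hf + mk g hg := rfl

theorem mk_mul {f g : (Fin n → ℝ) → ℝ} (hf : AnalyticAt ℝ f 0) (hg : AnalyticAt ℝ g 0) :
    mk (fun x => f x * g x) (hf.mul hg) = mk f hf * mk g hg := rfl

theorem mk_sum {ι : Type*} (s : Finset ι) (f : ι → (Fin n → ℝ) → ℝ)
    (hf : ∀ i, AnalyticAt ℝ (f i) 0) :
    mk (fun x => ∑ i ∈ s, f i x) (Finset.analyticAt_fun_sum s (fun i _ => hf i)) =
      ∑ i ∈ s, mk (f i) (hf i) := by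
  classical
  induction s using Finset.induction_on with
  | empty => rfl
  | insert a s ha ih =>
    rw [Finset.sum_insert ha, ← ih, ← mk_add, mk_eq_iff]
    simp [Finset.sum_insert ha]

theorem mk_pow {f : (Fin n → ℝ) → ℝ} (hf : AnalyticAt ℝ f 0) (k : ℕ) :
    mk (fun x => f x ^ k) (hf.pow k) = mk f hf ^ k := by
  induction k with
  | zero => simp only [pow_zero]; rfl
  | succ k ih => rw [pow_succ, ← ih, ← mk_mul, mk_eq_iff]; simp [pow_succ]

theorem mk_zero : mk (fun _ : Fin n → ℝ => (0 : ℝ)) analyticAt_const = 0 := rfl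
theorem mk_one : mk (fun _ : Fin n → ℝ => (1 : ℝ)) analyticAt_const = 1 := rfl

theorem mk_eq_zero {f : (Fin n → ℝ) → ℝ} {hf : AnalyticAt ℝ f 0} :
    mk f hf = 0 ↔ ∀ᶠ x in 𝓝 0, f x = 0 := by
  rw [← mk_zero, mk_eq_iff]

theorem ev_zero_or {E : Type*} [NormedAddCommGroup E] [NormedSpace ℝ E] {f g : E → ℝ}
    (hf : AnalyticAt ℝ f 0) (hg : AnalyticAt ℝ g 0) (h : ∀ᶠ x in 𝓝 0, f x * g x = 0) :
    (∀ᶠ x in 𝓝 0, f x = 0) ∨ (∀ᶠ x in 𝓝 0, g x = 0) := by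
  by_contra hc
  obtain ⟨hc1, hc2⟩ := not_or.1 hc
  obtain ⟨r, hr, hU⟩ := Metric.eventually_nhds_iff_ball.1
    ((hf.eventually_analyticAt).and ((hg.eventually_analyticAt).and h))
  have hgU : AnalyticOnNhd ℝ g (Metric.ball 0 r) := fun x hx => (hU x hx).2.1
  obtain ⟨x, hx, hfx⟩ : ∃ x ∈ Metric.ball (0 : E) r, f x ≠ 0 := by
    by_contra! hcc
    exact hc1 (Metric.eventually_nhds_iff_ball.2 ⟨r, hr, hcc⟩)
  have h1 : ∀ᶠ y in 𝓝 x, f y ≠ 0 := (hU x hx).1.continuousAt.eventually_ne hfx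
  have h2 : g =ᶠ[𝓝 x] 0 := by
    filter_upwards [h1, Metric.isOpen_ball.mem_nhds hx] with y hy hy2
    exact (mul_eq_zero.1 (hU y hy2).2.2).resolve_left hy
  have h3 := hgU.eqOn_zero_of_preconnected_of_eventuallyEq_zero
    (convex_ball (0 : E) r).isPreconnected hx h2
  exact hc2 (Metric.eventually_nhds_iff_ball.2 ⟨r, hr, fun y hy => h3 hy⟩)

instance : Nontrivial (An n) := by
  refine ⟨0, 1, fun h => ?_⟩
  rw [← mk_zero, ← mk_one, mk_eq_iff] at h
  simpa using h.self_of_nhds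

instance : IsDomain (An n) := by
  have : NoZeroDivisors (An n) := ⟨by
    intro a b hab
    obtain ⟨f, hf, rfl⟩ := mk_surj a
    obtain ⟨g, hg, rfl⟩ := mk_surj b
    rw [← mk_mul, mk_eq_zero] at hab
    rw [mk_eq_zero, mk_eq_zero]
    exact ev_zero_or hf hg hab⟩
  exact NoZeroDivisors.to_isDomain _

instance : Algebra ℝ (An n) := RingHom.toAlgebra
  { toFun := fun c => mk (fun _ => c) analyticAt_const
    map_one' := rfl
    map_mul' := fun _ _ => rfl
    map_zero' := rfl
    map_add' := fun _ _ => rfl }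

theorem algebraMap_eq (c : ℝ) : algebraMap ℝ (An n) c = mk (fun _ => c) analyticAt_const := rfl

instance : CharZero (An n) := charZero_of_injective_algebraMap (algebraMap ℝ (An n)).injective

theorem isUnit_mk {f : (Fin n → ℝ) → ℝ} {hf : AnalyticAt ℝ f 0} (h : f 0 ≠ 0) :
    IsUnit (mk f hf) := by
  refine IsUnit.of_mul_eq_one (mk (fun x => (f x)⁻¹) (hf.inv h)) ?_
  rw [← mk_mul, ← mk_one, mk_eq_iff]
  filter_upwards [hf.continuousAt.eventually_ne h] with x hx
  exact mul_inv_cancel₀ hx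

end An

end

section
open Filter Topology

/-- A positive integer weight on exponents, injective by unique factorisation. -/
noncomputable def wt {n : ℕ} (α : Fin n → ℕ) : ℕ := ∏ i : Fin n, (Nat.nth Nat.Prime i) ^ α i

theorem wt_factorization {n : ℕ} (α : Fin n → ℕ) (j : Fin n) :
    (wt α).factorization (Nat.nth Nat.Prime j) = α j := by
  unfold wt
  rw [Nat.factorization_prod (fun i _ => pow_ne_zero _ (Nat.prime_nth_prime _).ne_zero),
    Finsupp.finsetSum_apply, Finset.sum_eq_single j]
  · rw [(Nat.prime_nth_prime _).factorization_pow]; simp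
  · intro i _ hij
    rw [(Nat.prime_nth_prime _).factorization_pow]
    rw [Finsupp.single_apply, if_neg]
    intro h
    exact hij (Fin.ext (Nat.nth_injective Nat.infinite_setOfPred_prime h))
  · simp

theorem wt_inj {n : ℕ} {α β : Fin n → ℕ} (h : wt α = wt β) : α = β := by
  funext j
  rw [← wt_factorization α j, h, wt_factorization]

theorem mono_wt {n : ℕ} (α : Fin n → ℕ) :
    mono α (fun i : Fin n => ((Nat.nth Nat.Prime i : ℕ) : ℝ)) = (wt α : ℝ) := by
  simp [mono, wt]

/-- `α` is the initial exponent of the coefficient family `c`. -/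
def IsInit {n : ℕ} (c : (Fin n → ℕ) → ℝ) (α : Fin n → ℕ) : Prop :=
  c α ≠ 0 ∧ ∀ δ, δ ≠ α → c δ ≠ 0 → wt α < wt δ

theorem exists_isInit {n : ℕ} (c : (Fin n → ℕ) → ℝ) (h : c ≠ 0) : ∃ α, IsInit c α := by
  classical
  obtain ⟨β, hβ⟩ := Function.ne_iff.1 h
  let S : Set (Fin n → ℕ) := {α | c α ≠ 0}
  have hS : S.Nonempty := ⟨β, hβ⟩
  refine ⟨Function.argminOn wt S hS, Function.argminOn_mem wt S hS, fun δ hδ hc => ?_⟩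
  refine lt_of_le_of_ne (Function.argminOn_le wt S hc) (fun h => hδ (wt_inj h).symm)

theorem HasCoef.smul {n : ℕ} {f : (Fin n → ℝ) → ℝ} {a : (Fin n → ℕ) → ℝ}
    (h : HasCoef f a) (b : ℝ) : HasCoef (fun x => b * f x) (fun α => b * a α) := by
  obtain ⟨r, hr, hs, he⟩ := h
  refine ⟨r, hr, ?_, ?_⟩
  · refine (hs.mul_left |b|).congr (fun α => ?_)
    rw [abs_mul, mul_assoc]
  · filter_upwards [he] with x hx
    rw [hx, ← tsum_mul_left]
    simp only [mul_assoc]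

theorem dickson {n : ℕ} (E : Set (Fin n → ℕ)) :
    ∃ T : Finset (Fin n → ℕ), (∀ τ ∈ T, τ ∈ E) ∧ ∀ β ∈ E, ∃ τ ∈ T, τ ≤ β := by
  have hp : E.IsPWO := Set.isPWO_of_wellQuasiOrderedLE E
  have hanti : IsAntichain (· ≤ ·) {x | Minimal (· ∈ E) x} := setOfPred_minimal_antichain _
  have hfin : {x | Minimal (· ∈ E) x}.Finite := by
    by_contra hinf
    have h2 := (Set.isPWO_of_wellQuasiOrderedLE {x | Minimal (· ∈ E) x})
    exact hinf (hanti.finite_of_partiallyWellOrderedOn h2)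
  refine ⟨hfin.toFinset, fun τ hτ => ?_, fun β hβ => ?_⟩
  · exact (hfin.mem_toFinset.1 hτ).1
  · obtain ⟨m, hm1, hm2⟩ := hp.exists_le_minimal hβ
    exact ⟨m, hfin.mem_toFinset.2 hm2, hm1⟩

instance An.noetherian {n : ℕ} : IsNoetherianRing (An n) := by
  classical
  rw [isNoetherianRing_iff_ideal_fg]
  intro I
  let E : Set (Fin n → ℕ) := {α | ∃ (f : (Fin n → ℝ) → ℝ) (c : (Fin n → ℕ) → ℝ) (h : HasCoef f c),
    An.mk f h.analyticAt ∈ I ∧ IsInit c α ∧ c α = 1}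
  obtain ⟨T, hT1, hT2⟩ := dickson E
  choose! g cg hg1 hg2 using hT1
  choose hgI hgin hgone using hg2
  refine ⟨T.attach.image (fun τ => An.mk (g τ.1) (hg1 τ.1 τ.2).analyticAt), ?_⟩
  refine le_antisymm (Ideal.span_le.2 ?_) ?_
  · intro x hx
    simp only [Finset.coe_image, Set.mem_image, Finset.mem_coe, Finset.mem_attach, true_and] at hx
    obtain ⟨τ, rfl⟩ := hx
    exact hgI τ.1 τ.2
  · intro φ hφ
    obtain ⟨f, hf, rfl⟩ := An.mk_surj φ
    obtain ⟨q, c, r, hq, hr, hc, he⟩ := analytic_division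
      (fun i : Fin n => ((Nat.nth Nat.Prime i : ℕ) : ℝ))
      (fun i => by exact_mod_cast (Nat.prime_nth_prime i).two_le) T g cg hg1 hgone
      (fun τ hτ δ hδ hc => by
        rw [mono_wt, mono_wt]; exact_mod_cast (hgin τ hτ).2 δ hδ hc) f hf
    have key : An.mk f hf = ∑ τ : T, An.mk (q τ.1) (hq τ.1) *
        An.mk (g τ.1) (hg1 τ.1 τ.2).analyticAt + An.mk r hr.analyticAt := by
      simp only [← An.mk_mul]
      rw [← An.mk_sum (Finset.univ : Finset T) (fun τ x => q τ.1 x * g τ.1 x)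
        (fun τ => (hq τ.1).mul (hg1 τ.1 τ.2).analyticAt), ← An.mk_add, An.mk_eq_iff]
      filter_upwards [he] with x hx
      rw [hx, ← Finset.sum_coe_sort]
    have hsum : ∀ J : Ideal (An n), (∀ τ : T, An.mk (g τ.1) (hg1 τ.1 τ.2).analyticAt ∈ J) →
        ∑ τ : T, An.mk (q τ.1) (hq τ.1) * An.mk (g τ.1) (hg1 τ.1 τ.2).analyticAt ∈ J :=
      fun J hJ => J.sum_mem (fun τ _ => J.mul_mem_left _ (hJ τ))
    have hrI : An.mk r hr.analyticAt ∈ I := by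
      have := I.sub_mem hφ (hsum I (fun τ => hgI τ.1 τ.2))
      rw [key] at this
      simpa using this
    have hc0 : c = 0 := by
      by_contra hne
      obtain ⟨α, hα⟩ := exists_isInit c hne
      have hαE : α ∈ E := by
        refine ⟨_, _, hr.smul (c α)⁻¹, ?_, ⟨?_, ?_⟩, inv_mul_cancel₀ hα.1⟩
        · exact I.mul_mem_left (An.mk (fun _ => (c α)⁻¹) analyticAt_const) hrI
        · simp [hα.1]
        · intro δ hδ hcδ
          exact hα.2 δ hδ (right_ne_zero_of_mul hcδ)
      exact hα.1 (hc α (hT2 α hαE))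
    have hr0 : An.mk r hr.analyticAt = 0 := by
      rw [An.mk_eq_zero]
      obtain ⟨ρ, _, _, h3⟩ := hr
      filter_upwards [h3] with x hx
      rw [hx, hc0]; simp
    rw [key, hr0, add_zero]
    refine hsum _ (fun τ => Ideal.subset_span ?_)
    simp only [Finset.coe_image, Set.mem_image, Finset.mem_coe, Finset.mem_attach, true_and]
    exact ⟨τ, rfl⟩

end

section
open Filter Topology

theorem mono_cons {n : ℕ} (j : ℕ) (γ : Fin n → ℕ) (x : Fin (n+1) → ℝ) :
    mono (Fin.cons j γ : Fin (n+1) → ℕ) x = x 0 ^ j * mono γ (Fin.tail x) := by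
  simp [mono, Fin.prod_univ_succ, Fin.tail]

theorem regroup {n : ℕ} (d : ℕ) (r : (Fin (n+1) → ℝ) → ℝ) (c : (Fin (n+1) → ℕ) → ℝ)
    (hr : HasCoef r c) (hc : ∀ β, d ≤ β 0 → c β = 0) :
    ∃ e : ℕ → (Fin n → ℝ) → ℝ, (∀ j, AnalyticAt ℝ (e j) 0) ∧
      ∀ᶠ x in 𝓝 (0 : Fin (n+1) → ℝ), r x = ∑ j ∈ Finset.range d, e j (Fin.tail x) * x 0 ^ j := by
  obtain ⟨ρ, hρ, hs, he⟩ := hr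
  let ε : ℕ × (Fin n → ℕ) ≃ (Fin (n+1) → ℕ) := Fin.consEquiv (fun _ => ℕ)
  have hs2 : Summable (fun p : ℕ × (Fin n → ℕ) => |c (Fin.cons p.1 p.2)| * ρ ^ (p.1 + ∑ i, p.2 i)) := by
    refine (ε.summable_iff.2 hs).congr (fun p => ?_)
    have : ε p = Fin.cons p.1 p.2 := rfl
    simp [this, Fin.sum_univ_succ]
  refine ⟨fun j y => ∑' γ, c (Fin.cons j γ) * mono γ y, fun j => ?_, ?_⟩
  · apply analyticAt_of_summable _ ρ hρ
    have h1 := (hs2.prod_factor j).mul_left (ρ ^ j)⁻¹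
    refine h1.congr (fun γ => ?_)
    rw [pow_add]; field_simp
  · have hball : ∀ᶠ x in 𝓝 (0 : Fin (n+1) → ℝ), ∀ i, |x i| ≤ ρ := by
      filter_upwards [Metric.closedBall_mem_nhds (0 : Fin (n+1) → ℝ) hρ] with x hx i
      exact (norm_le_pi_norm x i).trans (mem_closedBall_zero_iff.1 hx)
    filter_upwards [he, hball] with x hx hb
    have hs3 : Summable (fun α => c α * mono α x) := by
      refine Summable.of_norm_bounded hs (fun α => ?_)
      rw [norm_mul]
      exact mul_le_mul_of_nonneg_left (mono_abs_le α x ρ hb) (abs_nonneg _)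
    have hs4 : Summable (fun p : ℕ × (Fin n → ℕ) => c (Fin.cons p.1 p.2) *
        mono (Fin.cons p.1 p.2 : Fin (n+1) → ℕ) x) := by
      have h6 := (ε.summable_iff (f := fun α => c α * mono α x)).2 hs3
      exact h6.congr (fun p => rfl)
    have h5 : ∑' α, c α * mono α x = ∑' p : ℕ × (Fin n → ℕ), c (Fin.cons p.1 p.2) *
        mono (Fin.cons p.1 p.2 : Fin (n+1) → ℕ) x :=
      (ε.tsum_eq (fun α => c α * mono α x)).symm
    rw [hx, h5, hs4.tsum_prod, tsum_eq_sum (s := Finset.range d)]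
    · refine Finset.sum_congr rfl (fun j _ => ?_)
      rw [← tsum_mul_right]
      refine tsum_congr (fun γ => ?_)
      rw [mono_cons]; ring
    · intro j hj
      have : ∀ γ : Fin n → ℕ, c (Fin.cons j γ) = 0 := fun γ =>
        hc _ (by simpa using hj)
      simp [this]

theorem weierstrass {n : ℕ} (h : (Fin (n+1) → ℝ) → ℝ) (hh : AnalyticAt ℝ h 0)
    (hreg : ¬ ∀ᶠ s in 𝓝 (0:ℝ), h (Pi.single 0 s) = 0) :
    ∃ d : ℕ, ∀ f : (Fin (n+1) → ℝ) → ℝ, AnalyticAt ℝ f 0 →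
      ∃ (q : (Fin (n+1) → ℝ) → ℝ) (e : ℕ → (Fin n → ℝ) → ℝ), AnalyticAt ℝ q 0 ∧
        (∀ j, AnalyticAt ℝ (e j) 0) ∧
        ∀ᶠ x in 𝓝 (0 : Fin (n+1) → ℝ),
          f x = q x * h x + ∑ j ∈ Finset.range d, e j (Fin.tail x) * x 0 ^ j := by
  classical
  obtain ⟨a, ha⟩ := hasCoef_of_analyticAt h hh
  have hsupp : ∀ δ : Fin (n+1) → ℕ, (∀ i : Fin n, δ i.succ = 0) → δ = Pi.single 0 (δ 0) := by
    intro δ hδ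
    funext i
    refine Fin.cases ?_ (fun i => ?_) i
    · simp
    · simp [hδ i]
  have hex : ∃ k : ℕ, a (Pi.single 0 k) ≠ 0 := by
    by_contra! hcon
    apply hreg
    obtain ⟨ρ, _, _, he⟩ := ha
    have ht : Tendsto (fun s : ℝ => (Pi.single 0 s : Fin (n+1) → ℝ)) (𝓝 0) (𝓝 0) := by
      have : Continuous (fun s : ℝ => (Pi.single 0 s : Fin (n+1) → ℝ)) := by
        refine continuous_pi (fun i => ?_)
        refine Fin.cases ?_ (fun i => ?_) i
        · simpa using continuous_id'
        · simpa using continuous_const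
      simpa using this.tendsto 0
    filter_upwards [ht.eventually he] with s hs
    rw [hs]
    have : ∀ α, a α * mono α (Pi.single 0 s : Fin (n+1) → ℝ) = 0 := by
      intro α
      by_cases hα : ∀ i : Fin n, α i.succ = 0
      · rw [hsupp α hα, hcon, zero_mul]
      · push Not at hα
        obtain ⟨i, hi⟩ := hα
        have : mono α (Pi.single 0 s : Fin (n+1) → ℝ) = 0 :=
          Finset.prod_eq_zero (Finset.mem_univ i.succ) (by simp [hi])
        rw [this, mul_zero]
    simp [this]
  let d := Nat.find hex
  have hd : a (Pi.single 0 d) ≠ 0 := Nat.find_spec hex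
  have hdmin : ∀ k, k < d → a (Pi.single 0 k) = 0 := fun k hk => by
    simpa using Nat.find_min hex hk
  refine ⟨d, fun f hf => ?_⟩
  let b := (a (Pi.single 0 d))⁻¹
  let B : Fin (n+1) → ℝ := Fin.cons 2 (fun _ => 2 ^ (d+1))
  have hB : ∀ i, 2 ≤ B i := by
    intro i
    refine Fin.cases ?_ (fun i => ?_) i
    · simp [B]
    · simp only [B, Fin.cons_succ]
      calc (2:ℝ) = 2 ^ 1 := by norm_num
        _ ≤ 2 ^ (d+1) := pow_le_pow_right₀ (by norm_num) (by omega)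
  have hmono0 : ∀ k : ℕ, mono (Pi.single 0 k) B = 2 ^ k := by
    intro k
    simp [mono, Fin.prod_univ_succ, B]
  obtain ⟨q, c, r, hq, hr, hc, he⟩ := analytic_division B hB {Pi.single 0 d}
    (fun _ x => b * h x) (fun _ α => b * a α) (fun _ _ => ha.smul b)
    (fun τ hτ => by
      rw [Finset.mem_singleton.1 hτ]; exact inv_mul_cancel₀ hd)
    (fun τ hτ δ hδ hcδ => by
      rw [Finset.mem_singleton.1 hτ] at hδ ⊢
      rw [hmono0]
      have haδ := right_ne_zero_of_mul hcδ
      by_cases hα : ∀ i : Fin n, δ i.succ = 0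
      · have h1 := hsupp δ hα
        rw [h1, hmono0]
        rw [h1] at haδ hδ
        refine pow_lt_pow_right₀ (by norm_num) ?_
        by_contra! hlt
        rcases hlt.lt_or_eq with h2 | h2
        · exact haδ (hdmin _ h2)
        · exact hδ (by rw [h2])
      · push Not at hα
        obtain ⟨i, hi⟩ := hα
        have hone : ∀ j, 1 ≤ B j ^ δ j := fun j => one_le_pow₀ (by linarith [hB j])
        have h1 : B i.succ ^ δ i.succ ≤ mono δ B := by
          unfold mono
          rw [← Finset.mul_prod_erase _ _ (Finset.mem_univ i.succ)]
          have : 1 ≤ ∏ j ∈ Finset.univ.erase i.succ, B j ^ δ j := by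
            calc (1:ℝ) = ∏ j ∈ Finset.univ.erase i.succ, 1 := by simp
              _ ≤ _ := Finset.prod_le_prod (fun _ _ => by norm_num) (fun j _ => hone j)
          have h0 := hone i.succ
          nlinarith
        have h2 : B i.succ ≤ B i.succ ^ δ i.succ := le_self_pow₀ (by linarith [hB i.succ]) hi
        have h3 : B i.succ = 2 ^ (d+1) := by simp [B]
        have h4 : (2:ℝ) ^ d < 2 ^ (d+1) := pow_lt_pow_right₀ (by norm_num) (by omega)
        linarith) f hf
  obtain ⟨e, he1, he2⟩ := regroup d r c hr (fun β hβ => hc β ⟨_, Finset.mem_singleton_self _, by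
    intro i
    refine Fin.cases ?_ (fun i => ?_) i
    · simpa using hβ
    · simp⟩)
  refine ⟨fun x => q (Pi.single 0 d) x * b, e, (hq _).mul analyticAt_const, he1, ?_⟩
  filter_upwards [he, he2] with x hx hx2
  rw [hx, ← hx2, Finset.sum_singleton]; ring

end

section
open Filter Topology

/-- Partial derivative. -/
noncomputable def pdv {n : ℕ} (i : Fin n) (f : (Fin n → ℝ) → ℝ) : (Fin n → ℝ) → ℝ :=
  fun x => fderiv ℝ f x (Pi.single i 1)

theorem pdv_an {n : ℕ} (i : Fin n) {f : (Fin n → ℝ) → ℝ} (hf : AnalyticAt ℝ f 0) :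
    AnalyticAt ℝ (pdv i f) 0 :=
  ((ContinuousLinearMap.apply ℝ ℝ (Pi.single i (1:ℝ) : Fin n → ℝ)).analyticAt _).comp hf.fderiv

theorem coord_an {n : ℕ} (i : Fin n) : AnalyticAt ℝ (fun x : Fin n → ℝ => x i) 0 :=
  (ContinuousLinearMap.proj (R := ℝ) (φ := fun _ : Fin n => ℝ) i).analyticAt 0

theorem pdv_congr {n : ℕ} (i : Fin n) {f g : (Fin n → ℝ) → ℝ} (h : ∀ᶠ x in 𝓝 0, f x = g x) :
    ∀ᶠ x in 𝓝 0, pdv i f x = pdv i g x := by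
  have : f =ᶠ[𝓝 0] g := h
  filter_upwards [this.fderiv (𝕜 := ℝ)] with x hx
  simp [pdv, hx]

theorem ev_diff {n : ℕ} {f : (Fin n → ℝ) → ℝ} (hf : AnalyticAt ℝ f 0) :
    ∀ᶠ x in 𝓝 0, DifferentiableAt ℝ f x :=
  hf.eventually_analyticAt.mono fun _ h => h.differentiableAt

theorem pdv_add {n : ℕ} (i : Fin n) {f g : (Fin n → ℝ) → ℝ} (hf : AnalyticAt ℝ f 0)
    (hg : AnalyticAt ℝ g 0) :
    ∀ᶠ x in 𝓝 0, pdv i (fun x => f x + g x) x = pdv i f x + pdv i g x := by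
  filter_upwards [ev_diff hf, ev_diff hg] with x h1 h2
  simp [pdv, fderiv_fun_add h1 h2]

theorem pdv_mul {n : ℕ} (i : Fin n) {f g : (Fin n → ℝ) → ℝ} (hf : AnalyticAt ℝ f 0)
    (hg : AnalyticAt ℝ g 0) :
    ∀ᶠ x in 𝓝 0, pdv i (fun x => f x * g x) x = f x * pdv i g x + g x * pdv i f x := by
  filter_upwards [ev_diff hf, ev_diff hg] with x h1 h2
  simp [pdv, fderiv_fun_mul h1 h2]

theorem pdv_coord {n : ℕ} (i j : Fin n) (x : Fin n → ℝ) :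
    pdv i (fun x : Fin n → ℝ => x j) x = if i = j then 1 else 0 := by
  have : fderiv ℝ (fun x : Fin n → ℝ => x j) x =
      ContinuousLinearMap.proj (R := ℝ) (φ := fun _ : Fin n => ℝ) j :=
    (ContinuousLinearMap.proj (R := ℝ) (φ := fun _ : Fin n => ℝ) j).fderiv
  simp [pdv, this, Pi.single_apply, eq_comm]

theorem pdv_comp {n m : ℕ} (M : (Fin m → ℝ) →L[ℝ] (Fin n → ℝ)) (i : Fin m)
    {f : (Fin n → ℝ) → ℝ} (hf : AnalyticAt ℝ f 0) :
    ∀ᶠ x in 𝓝 0, pdv i (fun x => f (M x)) x = ∑ j, M (Pi.single i 1) j * pdv j f (M x) := by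
  have ht : Tendsto M (𝓝 0) (𝓝 0) := by simpa using M.continuous.tendsto 0
  filter_upwards [ht.eventually (ev_diff hf)] with x hx
  have h1 : fderiv ℝ (fun x => f (M x)) x = (fderiv ℝ f (M x)).comp M := by
    have := hx.hasFDerivAt.comp x M.hasFDerivAt
    exact this.fderiv
  simp only [pdv, h1, ContinuousLinearMap.comp_apply]
  conv_lhs => rw [pi_eq_sum_univ' (M (Pi.single i 1))]
  rw [map_sum]
  refine Finset.sum_congr rfl (fun j _ => ?_)
  rw [map_smul, smul_eq_mul]

theorem comp_an {n m : ℕ} (M : (Fin m → ℝ) →L[ℝ] (Fin n → ℝ))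
    {f : (Fin n → ℝ) → ℝ} (hf : AnalyticAt ℝ f 0) : AnalyticAt ℝ (fun x => f (M x)) 0 := by
  have h1 : AnalyticAt ℝ f (M 0) := by simpa using hf
  exact h1.comp (M.analyticAt 0)

/-- Pullback of germs by a linear map. -/
noncomputable def pull {n m : ℕ} (M : (Fin m → ℝ) →L[ℝ] (Fin n → ℝ)) : An n →+* An m where
  toFun φ := An.mk (fun x => (An.mk_surj φ).choose (M x))
    (comp_an M (An.mk_surj φ).choose_spec.choose)
  map_one' := by
    have h := (An.mk_surj (1 : An n)).choose_spec.choose_spec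
    have ht : Tendsto M (𝓝 0) (𝓝 0) := by simpa using M.continuous.tendsto 0
    rw [← An.mk_one, An.mk_eq_iff] at h
    refine (An.mk_eq_iff (g := fun _ => 1) (hg := analyticAt_const)).2 ?_
    filter_upwards [ht.eventually h] with x hx using hx.symm
  map_zero' := by
    have h := (An.mk_surj (0 : An n)).choose_spec.choose_spec
    have ht : Tendsto M (𝓝 0) (𝓝 0) := by simpa using M.continuous.tendsto 0
    rw [← An.mk_zero, An.mk_eq_iff] at h
    refine (An.mk_eq_iff (g := fun _ => 0) (hg := analyticAt_const)).2 ?_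
    filter_upwards [ht.eventually h] with x hx using hx.symm
  map_mul' a b := by
    have ht : Tendsto M (𝓝 0) (𝓝 0) := by simpa using M.continuous.tendsto 0
    have h1 := (An.mk_surj a).choose_spec.choose_spec
    have h2 := (An.mk_surj b).choose_spec.choose_spec
    have h := (An.mk_surj (a * b)).choose_spec.choose_spec
    have h3 := (congrArg₂ (· * ·) h1 h2).symm.trans h
    simp only [← An.mk_mul] at h3
    rw [An.mk_eq_iff] at h3
    rw [← An.mk_mul, An.mk_eq_iff]
    filter_upwards [ht.eventually h3] with x hx using hx.symm
  map_add' a b := by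
    have ht : Tendsto M (𝓝 0) (𝓝 0) := by simpa using M.continuous.tendsto 0
    have h1 := (An.mk_surj a).choose_spec.choose_spec
    have h2 := (An.mk_surj b).choose_spec.choose_spec
    have h := (An.mk_surj (a + b)).choose_spec.choose_spec
    have h3 := (congrArg₂ (· + ·) h1 h2).symm.trans h
    simp only [← An.mk_add] at h3
    rw [An.mk_eq_iff] at h3
    rw [← An.mk_add, An.mk_eq_iff]
    filter_upwards [ht.eventually h3] with x hx using hx.symm

theorem pull_mk {n m : ℕ} (M : (Fin m → ℝ) →L[ℝ] (Fin n → ℝ)) {f : (Fin n → ℝ) → ℝ}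
    (hf : AnalyticAt ℝ f 0) : pull M (An.mk f hf) = An.mk (fun x => f (M x)) (comp_an M hf) := by
  have ht : Tendsto M (𝓝 0) (𝓝 0) := by simpa using M.continuous.tendsto 0
  have h := (An.mk_surj (An.mk f hf)).choose_spec.choose_spec
  rw [An.mk_eq_iff] at h
  refine (An.mk_eq_iff (hf := comp_an M (An.mk_surj _).choose_spec.choose)).2 ?_
  filter_upwards [ht.eventually h] with x hx using hx.symm

/-- The chain rule for `D` along `χ`, for the function `f`. -/
def Chn {n : ℕ} {R : Type*} [CommRing R] (χ : An n →+* R) (D : Derivation ℤ R R)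
    (f : (Fin n → ℝ) → ℝ) (hf : AnalyticAt ℝ f 0) : Prop :=
  D (χ (An.mk f hf)) = ∑ i, χ (An.mk (pdv i f) (pdv_an i hf)) *
    D (χ (An.mk (fun x => x i) (coord_an i)))

section
variable {n : ℕ} {R : Type*} [CommRing R] {χ : An n →+* R} {D : Derivation ℤ R R}

theorem Chn.congr {f g : (Fin n → ℝ) → ℝ} {hf : AnalyticAt ℝ f 0} (hg : AnalyticAt ℝ g 0)
    (h : Chn χ D f hf) (he : ∀ᶠ x in 𝓝 0, g x = f x) : Chn χ D g hg := by
  unfold Chn at *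
  rw [(An.mk_eq_iff (hf := hg) (hg := hf)).2 he, h]
  refine Finset.sum_congr rfl (fun i _ => ?_)
  rw [An.mk_eq_iff.2 (pdv_congr i he)]

theorem Chn.add {f g : (Fin n → ℝ) → ℝ} {hf : AnalyticAt ℝ f 0} {hg : AnalyticAt ℝ g 0}
    (h1 : Chn χ D f hf) (h2 : Chn χ D g hg) : Chn χ D (fun x => f x + g x) (hf.add hg) := by
  unfold Chn at *
  rw [An.mk_add hf hg, map_add, map_add, h1, h2, ← Finset.sum_add_distrib]
  refine Finset.sum_congr rfl (fun i _ => ?_)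
  have : An.mk _ (pdv_an i (hf.add hg)) = An.mk _ (pdv_an i hf) + An.mk _ (pdv_an i hg) := by
    rw [← An.mk_add, An.mk_eq_iff]; exact pdv_add i hf hg
  rw [← add_mul, ← map_add, ← this]
  rfl

theorem pdv_mul_mk {f g : (Fin n → ℝ) → ℝ} (hf : AnalyticAt ℝ f 0) (hg : AnalyticAt ℝ g 0)
    (i : Fin n) : An.mk (pdv i (fun x => f x * g x)) (pdv_an i (hf.mul hg)) =
      An.mk f hf * An.mk _ (pdv_an i hg) + An.mk g hg * An.mk _ (pdv_an i hf) := by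
  rw [← An.mk_mul, ← An.mk_mul, ← An.mk_add, An.mk_eq_iff]
  exact pdv_mul i hf hg

theorem Chn.mul {f g : (Fin n → ℝ) → ℝ} {hf : AnalyticAt ℝ f 0} {hg : AnalyticAt ℝ g 0}
    (h1 : Chn χ D f hf) (h2 : Chn χ D g hg) : Chn χ D (fun x => f x * g x) (hf.mul hg) := by
  unfold Chn at *
  rw [An.mk_mul hf hg, map_mul, Derivation.leibniz, h1, h2, smul_eq_mul, smul_eq_mul, Finset.mul_sum,
    Finset.mul_sum, ← Finset.sum_add_distrib]
  refine Finset.sum_congr rfl (fun i _ => ?_)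
  rw [pdv_mul_mk hf hg, map_add, map_mul, map_mul]
  ring

theorem Chn.coord (i : Fin n) : Chn χ D (fun x => x i) (coord_an i) := by
  unfold Chn
  have : ∀ j, An.mk _ (pdv_an j (coord_an i)) = if j = i then 1 else 0 := by
    intro j
    split_ifs with h
    · rw [← An.mk_one, An.mk_eq_iff]; exact Eventually.of_forall fun x => by rw [pdv_coord, if_pos h]
    · rw [← An.mk_zero, An.mk_eq_iff]; exact Eventually.of_forall fun x => by rw [pdv_coord, if_neg h]
  simp only [this]
  rw [Finset.sum_eq_single i]
  · simp
  · intro j _ hj; simp [hj]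
  · simp

theorem Chn.one : Chn χ D (fun _ => 1) analyticAt_const := by
  unfold Chn
  have : ∀ j, An.mk _ (pdv_an j (analyticAt_const (v := (1:ℝ)) (x := (0 : Fin n → ℝ)) (𝕜 := ℝ))) = 0 := by
    intro j
    rw [← An.mk_zero, An.mk_eq_iff]
    exact Eventually.of_forall fun x => by simp [pdv]
  simp only [this]
  rw [An.mk_one, map_one, Derivation.map_one_eq_zero]; simp

theorem Chn.pow {f : (Fin n → ℝ) → ℝ} {hf : AnalyticAt ℝ f 0}
    (h1 : Chn χ D f hf) (k : ℕ) : Chn χ D (fun x => f x ^ k) (hf.pow k) := by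
  induction k with
  | zero => exact Chn.one.congr _ (Eventually.of_forall fun x => by simp)
  | succ k ih => exact (ih.mul h1).congr _ (Eventually.of_forall fun x => by simp [pow_succ])

theorem Chn.sum (d : ℕ) (f : ℕ → (Fin n → ℝ) → ℝ) (hf : ∀ j, AnalyticAt ℝ (f j) 0)
    (h : ∀ j, Chn χ D (f j) (hf j)) :
    Chn χ D (fun x => ∑ j ∈ Finset.range d, f j x)
      (Finset.analyticAt_fun_sum _ (fun i _ => hf i)) := by
  induction d with
  | zero =>
    unfold Chn
    have e1 : An.mk _ (Finset.analyticAt_fun_sum (Finset.range 0) (fun i _ => hf i)) = 0 := by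
      rw [← An.mk_zero, An.mk_eq_iff]; simp
    rw [e1, map_zero, map_zero]
    symm
    refine Finset.sum_eq_zero (fun i _ => ?_)
    have e2 : An.mk _ (pdv_an i (Finset.analyticAt_fun_sum (Finset.range 0) (fun i _ => hf i))) = 0 := by
      rw [← An.mk_zero, An.mk_eq_iff]; simp [pdv]
    rw [e2, map_zero, zero_mul]
  | succ d ih =>
    exact (ih.add (h d)).congr _ (Eventually.of_forall fun x => by simp [Finset.sum_range_succ])

theorem Chn.of_sq {q P : (Fin n → ℝ) → ℝ} (hq : AnalyticAt ℝ q 0) (hP : AnalyticAt ℝ P 0)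
    (h0 : χ (An.mk P hP) = 0) :
    Chn χ D (fun x => q x * P x * P x) ((hq.mul hP).mul hP) := by
  have hqP : AnalyticAt ℝ (fun x => q x * P x) 0 := hq.mul hP
  unfold Chn
  rw [An.mk_mul hqP hP, map_mul, h0, mul_zero, map_zero]
  symm
  refine Finset.sum_eq_zero (fun i _ => ?_)
  rw [pdv_mul_mk hqP hP, map_add, map_mul, map_mul, h0, An.mk_mul hq hP, map_mul, h0]
  ring

theorem mk_pdv_comp {m : ℕ} (M : (Fin m → ℝ) →L[ℝ] (Fin n → ℝ)) (i : Fin m)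
    {f : (Fin n → ℝ) → ℝ} (hf : AnalyticAt ℝ f 0) :
    An.mk (pdv i (fun x => f (M x))) (pdv_an i (comp_an M hf)) =
      ∑ j, algebraMap ℝ (An m) (M (Pi.single i 1) j) * pull M (An.mk (pdv j f) (pdv_an j hf)) := by
  simp only [pull_mk, An.algebraMap_eq, ← An.mk_mul]
  rw [← An.mk_sum Finset.univ (fun j x => M (Pi.single i 1) j * pdv j f (M x))
    (fun j => analyticAt_const.mul (comp_an M (pdv_an j hf))), An.mk_eq_iff]
  exact pdv_comp M i hf

/-- Transfer of the chain rule along a linear pullback. -/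
theorem Chn.pull {m : ℕ} (M : (Fin n → ℝ) →L[ℝ] (Fin m → ℝ))
    (h : ∀ f hf, Chn χ D f hf) (f : (Fin m → ℝ) → ℝ) (hf : AnalyticAt ℝ f 0) :
    Chn (χ.comp (pull M)) D f hf := by
  have key : ∀ j, D (χ (_root_.pull M (An.mk (fun x => x j) (coord_an j)))) =
      ∑ i, χ (algebraMap ℝ (An n) (M (Pi.single i 1) j)) *
        D (χ (An.mk (fun x => x i) (coord_an i))) := by
    intro j
    rw [pull_mk]
    have := h _ (comp_an M (coord_an j))
    unfold Chn at this
    rw [this]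
    refine Finset.sum_congr rfl (fun i _ => ?_)
    rw [mk_pdv_comp M i (coord_an j), Finset.sum_eq_single j]
    · have : An.mk _ (pdv_an j (coord_an j)) = 1 := by
        rw [← An.mk_one, An.mk_eq_iff]
        exact Eventually.of_forall fun x => by rw [pdv_coord, if_pos rfl]
      rw [this, map_one, mul_one]
    · intro k _ hk
      have : An.mk _ (pdv_an k (coord_an j)) = 0 := by
        rw [← An.mk_zero, An.mk_eq_iff]
        exact Eventually.of_forall fun x => by rw [pdv_coord, if_neg hk]
      rw [this, map_zero, mul_zero]
    · simp
  unfold Chn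
  simp only [RingHom.comp_apply, key]
  rw [pull_mk]
  have := h _ (comp_an M hf)
  unfold Chn at this
  rw [this]
  simp only [mk_pdv_comp M _ hf, map_sum, map_mul, Finset.sum_mul, Finset.mul_sum]
  rw [Finset.sum_comm]
  refine Finset.sum_congr rfl (fun j _ => Finset.sum_congr rfl (fun i _ => ?_))
  ring

end

end

section
open Filter Topology
open IsLocalRing

/-- The existence of a good derivation satisfying the chain rule. -/
def CR (W : Type*) [CommRing W] (t : W) (s n : ℕ) : Prop :=
  ∀ ψ : An n →+* W, ∃ D : Derivation ℤ (W ⧸ Ideal.span {t ^ s}) (W ⧸ Ideal.span {t ^ s}),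
    D (Ideal.Quotient.mk _ t) = Ideal.Quotient.mk _ t ∧
    (∀ x, ∃ y, D x = Ideal.Quotient.mk _ t * y) ∧
    ∀ f hf, Chn ((Ideal.Quotient.mk (Ideal.span {t ^ s})).comp ψ) D f hf

section
variable {W : Type*} [CommRing W] [IsDomain W] [IsLocalRing W]

theorem cr_units {n : ℕ} (t : W) (ht : maximalIdeal W = Ideal.span {t})
    (ht0 : t ≠ 0) (s : ℕ) (hs : 1 ≤ s) (ψ : An n →+* W) (hu : ∀ a : An n, a ≠ 0 → IsUnit (ψ a)) :
    ∃ D : Derivation ℤ (W ⧸ Ideal.span {t ^ s}) (W ⧸ Ideal.span {t ^ s}),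
    D (Ideal.Quotient.mk _ t) = Ideal.Quotient.mk _ t ∧
    (∀ x, ∃ y, D x = Ideal.Quotient.mk _ t * y) ∧
    ∀ f hf, Chn ((Ideal.Quotient.mk (Ideal.span {t ^ s})).comp ψ) D f hf := by
  let K' := FractionRing (An n)
  have : CharZero K' := charZero_of_injective_algebraMap (IsFractionRing.injective (An n) K')
  let Ψ : K' →+* W := IsLocalization.lift (M := nonZeroDivisors (An n)) (g := ψ)
    (fun y => hu y (nonZeroDivisors.ne_zero y.2))
  letI : Algebra K' W := Ψ.toAlgebra
  obtain ⟨D, h1, h2, h3⟩ := exists_derivation_local K' W t ht ht0 s hs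
  have h4 : ∀ a : An n, D (Ideal.Quotient.mk (Ideal.span {t ^ s}) (ψ a)) = 0 := by
    intro a
    have h5 := h3 (algebraMap (An n) K' a)
    have h6 : algebraMap K' (W ⧸ Ideal.span {t ^ s}) (algebraMap (An n) K' a) =
        Ideal.Quotient.mk (Ideal.span {t ^ s}) (ψ a) := by
      have : Ψ (algebraMap (An n) K' a) = ψ a := IsLocalization.lift_eq _ _
      rw [← this]; rfl
    rw [← h6]; exact h5
  refine ⟨D, h1, h2, fun f hf => ?_⟩
  unfold Chn
  exact (h4 _).trans (Finset.sum_eq_zero (fun i _ => mul_eq_zero_of_right _ (h4 _))).symm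

theorem cr_regular {n : ℕ} (t : W) (s : ℕ) (ih : CR W t s n) (ψ : An (n+1) →+* W)
    (h : (Fin (n+1) → ℝ) → ℝ) (hh : AnalyticAt ℝ h 0)
    (hreg : ¬ ∀ᶠ x in 𝓝 (0:ℝ), h (Pi.single 0 x) = 0) (hψ : ψ (An.mk h hh) ∈ Ideal.span {t}) :
    ∃ D : Derivation ℤ (W ⧸ Ideal.span {t ^ s}) (W ⧸ Ideal.span {t ^ s}),
    D (Ideal.Quotient.mk _ t) = Ideal.Quotient.mk _ t ∧
    (∀ x, ∃ y, D x = Ideal.Quotient.mk _ t * y) ∧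
    ∀ f hf, Chn ((Ideal.Quotient.mk (Ideal.span {t ^ s})).comp ψ) D f hf := by
  let tl : (Fin (n+1) → ℝ) →L[ℝ] (Fin n → ℝ) :=
    ContinuousLinearMap.pi (fun i => ContinuousLinearMap.proj i.succ)
  have htl : ∀ x, tl x = Fin.tail x := fun x => rfl
  obtain ⟨D, h1, h2, h3⟩ := ih (ψ.comp (pull tl))
  refine ⟨D, h1, h2, ?_⟩
  set χ := (Ideal.Quotient.mk (Ideal.span {t ^ s})).comp ψ with hχ
  have hP : χ (An.mk (fun x => h x ^ s) (hh.pow s)) = 0 := by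
    rw [An.mk_pow hh, hχ, RingHom.comp_apply, Ideal.Quotient.eq_zero_iff_mem, map_pow,
      Ideal.mem_span_singleton]
    exact pow_dvd_pow_of_dvd (Ideal.mem_span_singleton.1 hψ) s
  have hpull : ∀ (e : (Fin n → ℝ) → ℝ) (he : AnalyticAt ℝ e 0),
      Chn χ D (fun x => e (tl x)) (comp_an tl he) := by
    intro e he
    have h4 := h3 e he
    unfold Chn at h4 ⊢
    simp only [RingHom.comp_apply, pull_mk] at h4
    simp only [hχ, RingHom.comp_apply]
    rw [h4, Fin.sum_univ_succ]
    have e0 : An.mk _ (pdv_an 0 (comp_an tl he)) = 0 := by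
      rw [mk_pdv_comp tl 0 he]
      refine Finset.sum_eq_zero (fun j _ => ?_)
      have : tl (Pi.single 0 1) j = 0 := by simp [tl]
      rw [this]; simp
    have es : ∀ i : Fin n, An.mk _ (pdv_an i.succ (comp_an tl he)) =
        An.mk _ (comp_an tl (pdv_an i he)) := by
      intro i
      rw [mk_pdv_comp tl i.succ he, Finset.sum_eq_single i, pull_mk]
      · have : tl (Pi.single i.succ 1) i = 1 := by simp [tl]
        rw [this]; simp
      · intro j _ hj
        have : tl (Pi.single i.succ 1) j = 0 := by
          simp [tl, hj]
        rw [this]; simp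
      · simp
    rw [e0]
    simp only [es, map_zero, zero_mul, zero_add]
    rfl
  intro f hf
  obtain ⟨d, hd⟩ := weierstrass (fun x => h x ^ s * h x ^ s) ((hh.pow s).mul (hh.pow s)) (by
    intro hc
    rcases Nat.eq_zero_or_pos s with h0 | h0
    · subst h0
      have := hc.self_of_nhds
      simp at this
    · apply hreg
      filter_upwards [hc] with x hx
      have h0' : s ≠ 0 := by omega
      simpa [h0'] using hx)
  obtain ⟨q, e, hq, he, hfe⟩ := hd f hf
  have c1 : Chn χ D (fun x => q x * h x ^ s * h x ^ s) _ := Chn.of_sq hq (hh.pow s) hP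
  have c2 := Chn.sum (χ := χ) (D := D) d (fun j x => e j (tl x) * x 0 ^ j)
    (fun j => (comp_an tl (he j)).mul ((coord_an 0).pow j))
    (fun j => (hpull (e j) (he j)).mul ((Chn.coord 0).pow j))
  refine (c1.add c2).congr hf ?_
  filter_upwards [hfe] with x hx
  rw [hx]
  simp only [htl]
  ring

theorem cr_all (t : W) (ht : maximalIdeal W = Ideal.span {t})
    (ht0 : t ≠ 0) (s : ℕ) (hs : 1 ≤ s) (n : ℕ) : CR W t s n := by
  induction n with
  | zero =>
    intro ψ
    refine cr_units t ht ht0 s hs ψ (fun a ha => ?_)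
    obtain ⟨f, hf, rfl⟩ := An.mk_surj a
    refine (An.isUnit_mk ?_).map ψ
    intro h0
    apply ha
    rw [An.mk_eq_zero]
    exact Eventually.of_forall fun x => by rw [Subsingleton.elim x 0, h0]
  | succ n ih =>
    intro ψ
    by_cases hu : ∀ a : An (n+1), a ≠ 0 → IsUnit (ψ a)
    · exact cr_units t ht ht0 s hs ψ hu
    push Not at hu
    obtain ⟨a, ha, hua⟩ := hu
    obtain ⟨h, hh, rfl⟩ := An.mk_surj a
    have hmem : ψ (An.mk h hh) ∈ Ideal.span {t} := by
      rw [← ht]; exact (mem_maximalIdeal _).2 hua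
    have h0 : h 0 = 0 := by
      by_contra hne
      exact hua ((An.isUnit_mk hne).map ψ)
    obtain ⟨ρ, hρ, hU⟩ := Metric.eventually_nhds_iff_ball.1 hh.eventually_analyticAt
    obtain ⟨v, hv, hhv⟩ : ∃ x ∈ Metric.ball (0 : Fin (n+1) → ℝ) ρ, h x ≠ 0 := by
      by_contra! hcc
      exact ha (An.mk_eq_zero.2 (Metric.eventually_nhds_iff_ball.2 ⟨ρ, hρ, hcc⟩))
    have hv0 : v ≠ 0 := fun hv0 => hhv (hv0 ▸ h0)
    have hline : ¬ ∀ᶠ x in 𝓝 (0:ℝ), h (x • v) = 0 := by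
      intro hc
      have han : AnalyticOnNhd ℝ (fun x : ℝ => h (x • v)) (Set.Icc 0 1) := by
        intro x hx
        have h1 : AnalyticAt ℝ h (x • v) := hU _ (by
          rw [mem_ball_zero_iff] at hv ⊢
          rw [norm_smul, Real.norm_eq_abs, abs_of_nonneg hx.1]
          have := norm_nonneg v
          nlinarith [hx.2])
        have h2 : AnalyticAt ℝ (fun x : ℝ => x • v) x :=
          ((ContinuousLinearMap.id ℝ ℝ).smulRight v).analyticAt x
        exact AnalyticAt.comp' h1 h2
      have := han.eqOn_zero_of_preconnected_of_eventuallyEq_zero (convex_Icc 0 1).isPreconnected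
        (show (0:ℝ) ∈ Set.Icc (0:ℝ) 1 by simp) hc (show (1:ℝ) ∈ Set.Icc (0:ℝ) 1 by simp)
      simp at this
      exact hhv this
    have he0 : (Pi.single 0 1 : Fin (n+1) → ℝ) ≠ 0 := by
      intro h1; have := congrFun h1 0; simp at this
    obtain ⟨L, hL⟩ := SeparatingDual.exists_continuousLinearEquiv_apply_eq (R := ℝ) he0 hv0
    let M : (Fin (n+1) → ℝ) →L[ℝ] (Fin (n+1) → ℝ) := L
    let M' : (Fin (n+1) → ℝ) →L[ℝ] (Fin (n+1) → ℝ) := L.symm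
    have hMM : ∀ x, M (M' x) = x := fun x => L.apply_symm_apply x
    have hpp : (pull M').comp (pull M) = RingHom.id (An (n+1)) := by
      refine RingHom.ext (fun a => ?_)
      obtain ⟨g, hg, rfl⟩ := An.mk_surj a
      rw [RingHom.comp_apply, pull_mk, pull_mk]
      exact (An.mk_eq_iff (hg := hg)).2 (Eventually.of_forall fun x => by rw [hMM])
    obtain ⟨D, h1, h2, h3⟩ := cr_regular t s ih (ψ.comp (pull M')) (fun x => h (M x))
      (comp_an M hh) (by
        intro hc
        apply hline
        filter_upwards [hc] with x hx
        have : (Pi.single 0 x : Fin (n+1) → ℝ) = x • Pi.single 0 1 := by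
          rw [← Pi.single_smul]; simp
        rw [this, map_smul] at hx
        have h5 : M (Pi.single 0 1) = v := hL
        rwa [h5] at hx) (by
        have : (ψ.comp (pull M')) (An.mk (fun x => h (M x)) (comp_an M hh)) = ψ (An.mk h hh) := by
          rw [← pull_mk M hh, RingHom.comp_apply]
          exact congrArg ψ (congrArg (fun k => k (An.mk h hh)) hpp)
        rw [this]; exact hmem)
    refine ⟨D, h1, h2, fun f hf => ?_⟩
    have h4 := Chn.pull M h3 f hf
    rwa [RingHom.comp_assoc, RingHom.comp_assoc, hpp, RingHom.comp_id] at h4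

end

end

section
open IsLocalRing

theorem alg_lemma {A K : Type*} [CommRing A] [IsDomain A] [IsNoetherianRing A] [Field K]
    [Algebra A K] [IsFractionRing A K] (F : A) (hF : F ≠ 0) {ι : Type*} [Finite ι] (G : ι → A)
    (hno : ∀ (W : ValuationSubring K) (_ : ∀ r, algebraMap A K r ∈ W)
      (_ : ∀ i, algebraMap A K (G i) / algebraMap A K F ∈ W) (t u : W) (k : ℕ),
      maximalIdeal W = Ideal.span {t} → t ≠ 0 → IsUnit u → 1 ≤ k →
      algebraMap A K F = (u * t ^ k : W) → False) :
    ∃ (N : ℕ) (c : A), c ∈ (Ideal.span (insert F (Set.range G))) ^ N ∧ F ^ N = F * c := by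
  classical
  have hinj := IsFractionRing.injective A K
  have hFK : algebraMap A K F ≠ 0 := fun h => hF (hinj (by rw [h, map_zero]))
  let S : Set K := Set.range (fun i => algebraMap A K (G i) / algebraMap A K F)
  let B : Subalgebra A K := Algebra.adjoin A S
  have hnoeth : IsNoetherianRing B :=
    isNoetherianRing_of_fg (Subalgebra.fg_def.2 ⟨S, Set.finite_range _, rfl⟩)
  have hfr : IsFractionRing B K := by
    refine IsFractionRing.of_field B K (fun z => ?_)
    obtain ⟨x, y, hy, rfl⟩ := IsFractionRing.div_surjective (A := A) z
    exact ⟨algebraMap A B x, algebraMap A B y, rfl⟩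
  have hunit : IsUnit (algebraMap A B F) := by
    by_contra hu
    obtain ⟨W, hW, t, u, k, h1, h2, h3, h4, h5⟩ := dvr_exists (K := K) (algebraMap A B F)
      (fun h => hFK (congrArg Subtype.val h)) hu
    exact hno W (fun r => hW (algebraMap A B r))
      (fun i => hW ⟨_, Algebra.subset_adjoin ⟨i, rfl⟩⟩) t u k h1 h2 h3 h4
      (congrArg Subtype.val h5)
  set J := Ideal.span (insert F (Set.range G)) with hJ
  have hFJ : F ∈ J := Ideal.subset_span (Set.mem_insert _ _)
  have key : ∀ b ∈ Algebra.adjoin A S, ∃ (N : ℕ) (c : A), c ∈ J ^ N ∧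
      algebraMap A K F ^ N * b = algebraMap A K c := by
    intro b hb
    induction hb using Algebra.adjoin_induction with
    | mem x hx =>
      obtain ⟨i, rfl⟩ := hx
      refine ⟨1, G i, ?_, ?_⟩
      · rw [pow_one]; exact Ideal.subset_span (Set.mem_insert_of_mem _ ⟨i, rfl⟩)
      · field_simp
    | algebraMap r => exact ⟨0, r, by simp, by simp⟩
    | add x y _ _ hx hy =>
      obtain ⟨N, c, hc, hc2⟩ := hx
      obtain ⟨M, d, hd, hd2⟩ := hy
      refine ⟨N + M, F ^ M * c + F ^ N * d, ?_, ?_⟩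
      · refine Ideal.add_mem _ ?_ ?_
        · rw [pow_add, mul_comm (F ^ M)]; exact Ideal.mul_mem_mul hc (Ideal.pow_mem_pow hFJ M)
        · rw [pow_add]; exact Ideal.mul_mem_mul (Ideal.pow_mem_pow hFJ N) hd
      · simp only [map_add, map_mul, map_pow, ← hc2, ← hd2]; ring
    | mul x y _ _ hx hy =>
      obtain ⟨N, c, hc, hc2⟩ := hx
      obtain ⟨M, d, hd, hd2⟩ := hy
      refine ⟨N + M, c * d, ?_, ?_⟩
      · rw [pow_add]; exact Ideal.mul_mem_mul hc hd
      · simp only [map_mul, ← hc2, ← hd2]; ring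
  obtain ⟨b, hb⟩ := hunit.exists_right_inv
  obtain ⟨N, c, hc, hc2⟩ := key b.1 b.2
  refine ⟨N, c, hc, hinj ?_⟩
  have hb' : algebraMap A K F * b.1 = 1 := congrArg Subtype.val hb
  rw [map_pow, map_mul, ← hc2]
  calc algebraMap A K F ^ N = algebraMap A K F ^ N * (algebraMap A K F * b.1) := by rw [hb', mul_one]
    _ = _ := by ring

end

section
open Filter Topology
open IsLocalRing

theorem no_val {n : ℕ} (f : (Fin n → ℝ) → ℝ) (hf : AnalyticAt ℝ f 0)
    {K : Type*} [Field K] [Algebra (An n) K]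
    (hF : algebraMap (An n) K (An.mk f hf) ≠ 0)
    (W : ValuationSubring K) (hA : ∀ r, algebraMap (An n) K r ∈ W)
    (hG : ∀ i, algebraMap (An n) K (An.mk (pdv i f) (pdv_an i hf)) /
      algebraMap (An n) K (An.mk f hf) ∈ W) (t u : W) (k : ℕ)
    (ht : maximalIdeal W = Ideal.span {t}) (ht0 : t ≠ 0) (hu : IsUnit u) (hk : 1 ≤ k)
    (hval : algebraMap (An n) K (An.mk f hf) = (u * t ^ k : W)) : False := by
  let ψ : An n →+* W :=
    { toFun := fun r => ⟨algebraMap (An n) K r, hA r⟩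
      map_one' := Subtype.ext (map_one _)
      map_mul' := fun a b => Subtype.ext (map_mul _ a b)
      map_zero' := Subtype.ext (map_zero _)
      map_add' := fun a b => Subtype.ext (map_add _ a b) }
  obtain ⟨D, h1, h2, h3⟩ := cr_all t ht ht0 (k+1) (by omega) n ψ
  have h4 := h3 f hf
  unfold Chn at h4
  simp only [RingHom.comp_apply] at h4
  let π := Ideal.Quotient.mk (Ideal.span {t ^ (k+1)})
  have hπ : π t ^ (k+1) = 0 := by
    rw [← map_pow, Ideal.Quotient.eq_zero_iff_mem]; exact Ideal.mem_span_singleton_self _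
  have hψf : ψ (An.mk f hf) = u * t ^ k := Subtype.ext hval
  have hψg : ∀ i, ψ (An.mk (pdv i f) (pdv_an i hf)) = u * t ^ k * ⟨_, hG i⟩ := by
    intro i
    rw [← hψf]
    apply Subtype.ext
    change algebraMap (An n) K _ = algebraMap (An n) K _ * (_ / _)
    field_simp
  have hR : ∑ i, π (ψ (An.mk (pdv i f) (pdv_an i hf))) *
      D (π (ψ (An.mk (fun x => x i) (coord_an i)))) = 0 := by
    refine Finset.sum_eq_zero (fun i _ => ?_)
    obtain ⟨y, hy⟩ := h2 (π (ψ (An.mk (fun x => x i) (coord_an i))))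
    rw [hy, hψg, map_mul, map_mul, map_pow]
    calc π u * π t ^ k * π ⟨_, hG i⟩ * (π t * y) = π u * π ⟨_, hG i⟩ * y * π t ^ (k+1) := by ring
      _ = 0 := by rw [hπ, mul_zero]
  have h5 : D (π (u * t ^ k)) = 0 := by
    rw [← hψf]; exact h4.trans hR
  obtain ⟨y, hy⟩ := h2 (π u)
  have h6 : D (π (u * t ^ k)) = k * (π u * π t ^ k) := by
    rw [map_mul, map_pow, Derivation.leibniz, Derivation.leibniz_pow]
    have e1 : D (π t) = π t := h1
    have e2 : D (π u) = π t * y := hy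
    rw [e1, e2]
    simp only [smul_eq_mul, nsmul_eq_mul]
    obtain ⟨l, rfl⟩ : ∃ l, k = l + 1 := ⟨k - 1, by omega⟩
    simp only [Nat.add_sub_cancel]
    calc _ = ((l + 1 : ℕ) : W ⧸ Ideal.span {t ^ (l + 1 + 1)}) * (π u * π t ^ (l+1))
          + y * π t ^ (l + 1 + 1) := by ring
      _ = _ := by rw [hπ]; ring
  have h7 : π ((k : W) * (u * t ^ k)) = 0 := by
    rw [map_mul, map_natCast, map_mul, map_pow, ← h6, h5]
  rw [Ideal.Quotient.eq_zero_iff_mem, Ideal.mem_span_singleton] at h7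
  obtain ⟨z, hz⟩ := h7
  have h8 : (k : W) * u = t * z := by
    have : t ^ k ≠ 0 := pow_ne_zero _ ht0
    apply mul_right_cancel₀ this
    rw [mul_assoc, hz]; ring
  have hku : IsUnit (k : W) := by
    have e : ((ψ.comp (algebraMap ℝ (An n))) (k : ℝ)) = (k : W) := map_natCast _ k
    rw [← e]
    refine IsUnit.map _ (IsUnit.mk0 _ ?_)
    have : k ≠ 0 := by omega
    exact_mod_cast this
  have h9 : (k : W) * u ∈ maximalIdeal W := by
    rw [h8, ht]; exact Ideal.mul_mem_right _ _ (Ideal.mem_span_singleton_self _)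
  exact (mem_maximalIdeal _).1 h9 (hku.mul hu)

theorem bigO_of_mem {n : ℕ} (m : (Fin n → ℝ) → ℝ) (S : Set (An n))
    (hS : ∀ φ ∈ S, ∃ f hf, φ = An.mk f hf ∧ f =O[𝓝 0] m) (N : ℕ) :
    ∀ φ ∈ (Ideal.span S) ^ N, ∃ f hf, φ = An.mk f hf ∧ f =O[𝓝 0] (fun x => m x ^ N) := by
  have hone : ∀ f : (Fin n → ℝ) → ℝ, AnalyticAt ℝ f 0 → f =O[𝓝 0] (fun _ => (1:ℝ)) :=
    fun f hf => hf.continuousAt.tendsto.isBigO_one ℝ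
  have hspan : ∀ φ ∈ Ideal.span S, ∃ f hf, φ = An.mk f hf ∧ f =O[𝓝 0] m := by
    intro φ hφ
    induction hφ using Submodule.span_induction with
    | mem x hx => exact hS x hx
    | zero => exact ⟨fun _ => 0, analyticAt_const, rfl, Asymptotics.isBigO_zero _ _⟩
    | add x y _ _ hx hy =>
      obtain ⟨f, hf, rfl, h1⟩ := hx
      obtain ⟨g, hg, rfl, h2⟩ := hy
      exact ⟨_, hf.add hg, rfl, h1.add h2⟩
    | smul a x _ hx =>
      obtain ⟨f, hf, rfl, h1⟩ := hx
      obtain ⟨g, hg, rfl⟩ := An.mk_surj a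
      refine ⟨fun x => g x * f x, hg.mul hf, rfl, ?_⟩
      simpa using (hone g hg).mul h1
  induction N with
  | zero =>
    intro φ _
    obtain ⟨f, hf, rfl⟩ := An.mk_surj φ
    exact ⟨f, hf, rfl, by simpa using hone f hf⟩
  | succ N ih =>
    intro φ hφ
    rw [pow_succ] at hφ
    induction hφ using Submodule.mul_induction_on' with
    | mem_mul_mem a ha b hb =>
      obtain ⟨f, hf, rfl, h1⟩ := ih a ha
      obtain ⟨g, hg, rfl, h2⟩ := hspan b hb
      refine ⟨fun x => f x * g x, hf.mul hg, rfl, ?_⟩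
      simpa only [pow_succ] using h1.mul h2
    | add x _ y _ hx hy =>
      obtain ⟨f, hf, rfl, h1⟩ := hx
      obtain ⟨g, hg, rfl, h2⟩ := hy
      exact ⟨_, hf.add hg, rfl, h1.add h2⟩

theorem lojasiewicz {n : ℕ} (f : (Fin n → ℝ) → ℝ) (hf : AnalyticAt ℝ f 0) (h0 : f 0 = 0) :
    ∃ (N : ℕ) (C : ℝ), 0 < C ∧ ∀ᶠ x in 𝓝 0, |f x| ^ N ≤ C * (∑ i, |pdv i f x|) ^ (N+1) := by
  by_cases hz : An.mk f hf = 0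
  · rw [An.mk_eq_zero] at hz
    refine ⟨1, 1, one_pos, ?_⟩
    filter_upwards [hz] with x hx
    rw [hx]
    have : 0 ≤ ∑ i, |pdv i f x| := Finset.sum_nonneg (fun _ _ => abs_nonneg _)
    simp only [abs_zero, pow_one, one_mul]
    positivity
  let K := FractionRing (An n)
  have hFK : algebraMap (An n) K (An.mk f hf) ≠ 0 := fun h =>
    hz (IsFractionRing.injective (An n) K (by rw [h, map_zero]))
  obtain ⟨N, c, hc, hNc⟩ := alg_lemma (K := K) (An.mk f hf) hz
    (fun i => An.mk (pdv i f) (pdv_an i hf))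
    (fun W hA hG t u k h1 h2 h3 h4 h5 => no_val f hf hFK W hA hG t u k h1 h2 h3 h4 h5)
  have hnu : ¬ IsUnit (An.mk f hf) := by
    intro hu
    obtain ⟨b, hb⟩ := hu.exists_right_inv
    obtain ⟨g, hg, rfl⟩ := An.mk_surj b
    rw [← An.mk_mul, ← An.mk_one, An.mk_eq_iff] at hb
    have := hb.self_of_nhds
    simp [h0] at this
  obtain ⟨N, rfl⟩ : ∃ M, N = M + 1 := by
    cases N with
    | zero => exact absurd (IsUnit.of_mul_eq_one c (by rw [← hNc, pow_zero])) hnu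
    | succ M => exact ⟨M, rfl⟩
  have hcc : An.mk f hf ^ N = c := by
    apply mul_left_cancel₀ hz
    rw [← hNc, pow_succ']
  set g : (Fin n → ℝ) → ℝ := fun x => ∑ i, |pdv i f x| with hg
  have hg0 : ∀ x, 0 ≤ g x := fun x => Finset.sum_nonneg (fun _ _ => abs_nonneg _)
  obtain ⟨cf, hcf, hceq, hcO⟩ := bigO_of_mem (fun x => |f x| + g x) _ (by
    intro φ hφ
    rcases hφ with rfl | ⟨i, rfl⟩
    · refine ⟨f, hf, rfl, Asymptotics.IsBigO.of_norm_le (fun x => ?_)⟩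
      rw [Real.norm_eq_abs]
      linarith [hg0 x]
    · refine ⟨_, pdv_an i hf, rfl, Asymptotics.IsBigO.of_norm_le (fun x => ?_)⟩
      rw [Real.norm_eq_abs]
      have : |pdv i f x| ≤ g x :=
        Finset.single_le_sum (f := fun i => |pdv i f x|) (fun _ _ => abs_nonneg _) (Finset.mem_univ i)
      linarith [abs_nonneg (f x)]) (N+1) c hc
  obtain ⟨C, hC, hCb⟩ := hcO.exists_pos
  rw [Asymptotics.isBigOWith_iff] at hCb
  rw [hceq, ← An.mk_pow, An.mk_eq_iff] at hcc
  refine ⟨N, 2 * C * 2 ^ N, by positivity, ?_⟩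
  have hsmall : ∀ᶠ x in 𝓝 0, |f x| < 1 / (2 * C * 2 ^ N) := by
    have : Tendsto (fun x => |f x|) (𝓝 0) (𝓝 0) := by
      have := hf.continuousAt.abs.tendsto
      simpa [h0] using this
    exact this.eventually_lt_const (by positivity)
  filter_upwards [hCb, hcc, hsmall] with x h1 h2 h3
  rw [← h2, Real.norm_eq_abs, abs_pow, Real.norm_of_nonneg
    (pow_nonneg (add_nonneg (abs_nonneg _) (hg0 x)) _)] at h1
  have h4 := add_pow_le (abs_nonneg (f x)) (hg0 x) (N+1)
  simp only [Nat.add_sub_cancel] at h4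
  have h5 : C * 2 ^ N * |f x| ^ (N+1) ≤ |f x| ^ N / 2 := by
    rw [lt_div_iff₀ (by positivity)] at h3
    have : 0 ≤ |f x| ^ N := by positivity
    rw [pow_succ]
    nlinarith
  have h6 : C * (|f x| + g x) ^ (N+1) ≤ C * (2 ^ N * (|f x| ^ (N+1) + g x ^ (N+1))) :=
    mul_le_mul_of_nonneg_left h4 hC.le
  nlinarith

end

section
open Filter Topology

theorem loj_euclid {n : ℕ} (f : EuclideanSpace ℝ (Fin n) → ℝ) (p : EuclideanSpace ℝ (Fin n))
    (hf : AnalyticAt ℝ f p) : ∃ (N : ℕ) (C : ℝ), 0 < C ∧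
      ∀ᶠ y in 𝓝 p, |f y - f p| ^ N ≤ C * ‖gradient f y‖ ^ (N+1) := by
  let e : (Fin n → ℝ) ≃L[ℝ] EuclideanSpace ℝ (Fin n) := (EuclideanSpace.equiv (Fin n) ℝ).symm
  let φ : (Fin n → ℝ) → EuclideanSpace ℝ (Fin n) := fun x => p + e x
  have hφ : AnalyticAt ℝ φ 0 := analyticAt_const.add ((e : (Fin n → ℝ) →L[ℝ] EuclideanSpace ℝ (Fin n)).analyticAt 0)
  have hφ0 : φ 0 = p := by simp [φ]
  have hfφ : AnalyticAt ℝ (fun x => f (φ x) - f p) 0 := by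
    have h1 : AnalyticAt ℝ f (φ 0) := by rwa [hφ0]
    exact (AnalyticAt.fun_comp h1 hφ).sub analyticAt_const
  obtain ⟨N, C, hC, hev⟩ := lojasiewicz _ hfφ (by simp [hφ0])
  let Q : ℝ := ∑ i : Fin n, ‖e (Pi.single i 1)‖ + 1
  have hQ : 0 < Q := by
    have : 0 ≤ ∑ i : Fin n, ‖e (Pi.single i 1)‖ := Finset.sum_nonneg (fun _ _ => norm_nonneg _)
    linarith
  refine ⟨N, C * Q ^ (N+1), by positivity, ?_⟩
  have ht : Tendsto (fun y => e.symm (y - p)) (𝓝 p) (𝓝 0) := by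
    have : Continuous (fun y => e.symm (y - p)) := by fun_prop
    simpa using this.tendsto p
  filter_upwards [ht.eventually hev, hf.eventually_analyticAt] with y h1 h2
  have hy : φ (e.symm (y - p)) = y := by simp [φ]
  set x := e.symm (y - p)
  rw [hy] at h1
  refine h1.trans ?_
  rw [mul_assoc, ← mul_pow]
  refine mul_le_mul_of_nonneg_left (pow_le_pow_left₀ (Finset.sum_nonneg fun _ _ => abs_nonneg _) ?_ _) hC.le
  have hd : HasFDerivAt (fun x => f (φ x) - f p)
      ((fderiv ℝ f y).comp (e : (Fin n → ℝ) →L[ℝ] EuclideanSpace ℝ (Fin n))) x := by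
    have a1 : HasFDerivAt f (fderiv ℝ f y) (φ x) := by
      rw [hy]; exact h2.differentiableAt.hasFDerivAt
    have a2 : HasFDerivAt φ (e : (Fin n → ℝ) →L[ℝ] EuclideanSpace ℝ (Fin n)) x :=
      (e : (Fin n → ℝ) →L[ℝ] EuclideanSpace ℝ (Fin n)).hasFDerivAt.const_add p
    exact (a1.comp x a2).sub_const _
  have hg : ‖gradient f y‖ = ‖fderiv ℝ f y‖ := by
    unfold gradient; exact LinearIsometryEquiv.norm_map _ _
  rw [hg]
  calc ∑ i, |pdv i (fun x => f (φ x) - f p) x| ≤ ∑ i : Fin n, ‖e (Pi.single i 1)‖ * ‖fderiv ℝ f y‖ := by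
        refine Finset.sum_le_sum (fun i _ => ?_)
        unfold pdv
        rw [hd.fderiv, ← Real.norm_eq_abs, mul_comm]
        exact (fderiv ℝ f y).le_opNorm _
    _ ≤ Q * ‖fderiv ℝ f y‖ := by
        rw [← Finset.sum_mul]
        exact mul_le_mul_of_nonneg_right (by simp [Q]) (norm_nonneg _)

theorem rpow_aux (u g C : ℝ) (N : ℕ) (hu : 0 < u) (hg : 0 ≤ g) (hC : 0 < C)
    (h : u ^ N ≤ C * g ^ (N+1)) :
    g ≤ C ^ ((N+1 : ℕ) : ℝ)⁻¹ * (g ^ 2 * u ^ (((N+1 : ℕ) : ℝ)⁻¹ - 1)) := by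
  set q : ℝ := ((N+1 : ℕ) : ℝ)⁻¹ with hq
  have hq0 : 0 < q := by positivity
  have h1 : u ^ (1 - q) ≤ C ^ q * g := by
    have h2 := Real.rpow_le_rpow (by positivity) h hq0.le
    rw [Real.mul_rpow hC.le (by positivity), hq, Real.pow_rpow_inv_natCast hg (by omega),
      ← Real.rpow_natCast, ← Real.rpow_mul hu.le, ← hq] at h2
    have : (N : ℝ) * q = 1 - q := by
      rw [hq]; push_cast; field_simp; ring
    rwa [this] at h2
  have h3 : u ^ (1 - q) * u ^ (q - 1) = 1 := by
    rw [← Real.rpow_add hu]; simp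
  have h4 : 0 < u ^ (q - 1) := Real.rpow_pos_of_pos hu _
  calc g = g * (u ^ (1 - q) * u ^ (q - 1)) := by rw [h3, mul_one]
    _ ≤ g * (C ^ q * g * u ^ (q - 1)) := by gcongr
    _ = _ := by ring

theorem flow_lemma {E : Type*} [NormedAddCommGroup E] [InnerProductSpace ℝ E] [CompleteSpace E]
    (f : E → ℝ) (hf : Differentiable ℝ f) (p : E) (N : ℕ) (C : ℝ) (hC : 0 < C)
    (hloj : ∀ᶠ y in 𝓝 p, |f y - f p| ^ N ≤ C * ‖gradient f y‖ ^ (N+1))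
    (γ : ℝ → E) (hγ : ∀ t : ℝ, 0 ≤ t → HasDerivAt γ (-(gradient f (γ t))) t)
    (tj : ℕ → ℝ) (htj : Tendsto tj atTop atTop)
    (hseq : Tendsto (fun j => γ (tj j)) atTop (𝓝 p)) : Tendsto γ atTop (𝓝 p) := by
  set u : ℝ → ℝ := fun t => f (γ t) - f p with hu
  have hu' : ∀ t, 0 ≤ t → HasDerivAt u (-‖gradient f (γ t)‖ ^ 2) t := by
    intro t ht
    have h1 := ((hf (γ t)).hasGradientAt.hasFDerivAt.comp_hasDerivAt t (hγ t ht)).sub_const (f p)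
    exact h1.congr_deriv (by
      rw [InnerProductSpace.toDual_apply_apply, inner_neg_right, real_inner_self_eq_norm_sq])
  have hanti : AntitoneOn u (Set.Ici 0) := by
    refine antitoneOn_of_deriv_nonpos (convex_Ici 0) ?_ ?_ ?_
    · exact fun t ht => (hu' t ht).continuousAt.continuousWithinAt
    · intro t ht
      rw [interior_Ici] at ht
      exact (hu' t (le_of_lt ht)).differentiableAt.differentiableWithinAt
    · intro t ht
      rw [interior_Ici] at ht
      rw [(hu' t (le_of_lt ht)).deriv]
      simp
  have huj : Tendsto (fun j => u (tj j)) atTop (𝓝 0) := by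
    have h1 := ((hf.continuous.tendsto p).comp hseq).sub_const (f p)
    simpa using h1
  have hnn : ∀ t, 0 ≤ t → 0 ≤ u t := by
    intro t ht
    refine le_of_tendsto huj ?_
    filter_upwards [htj.eventually_ge_atTop t] with j hj
    exact hanti ht (ht.trans hj) hj
  by_cases hpos : ∀ t, 0 ≤ t → 0 < u t
  · set q : ℝ := ((N+1 : ℕ) : ℝ)⁻¹ with hq
    have hq0 : 0 < q := by positivity
    set K : ℝ := C ^ q / q with hK
    have hK0 : 0 < K := div_pos (Real.rpow_pos_of_pos hC _) hq0
    have hvj : Tendsto (fun j => K * (u (tj j)) ^ q) atTop (𝓝 0) := by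
      have := (huj.rpow_const (p := q) (Or.inr hq0.le)).const_mul K
      simpa [Real.zero_rpow hq0.ne'] using this
    obtain ⟨ρ, hρ, hball⟩ := Metric.eventually_nhds_iff_ball.1 hloj
    rw [Metric.tendsto_nhds]
    intro ε' hε'
    set ε := min ε' ρ with hε
    have hε0 : 0 < ε := lt_min hε' hρ
    obtain ⟨j, hj0, hj1, hj2⟩ := ((htj.eventually_ge_atTop 0).and
      (((Metric.tendsto_nhds.1 hseq) (ε/2) (by positivity)).and
        (hvj.eventually_lt_const (show (0:ℝ) < ε/2 by positivity)))).exists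
    set t0 := tj j with ht0
    filter_upwards [eventually_ge_atTop t0] with t ht
    by_contra hcon
    have hcon' : ε ≤ dist (γ t) p := (min_le_left _ _).trans (not_lt.1 hcon)
    have hcont : ContinuousOn γ (Set.Icc t0 t) := fun s hs =>
      (hγ s (hj0.trans hs.1)).continuousAt.continuousWithinAt
    let S : Set ℝ := {s ∈ Set.Icc t0 t | ε ≤ dist (γ s) p}
    have hScl : IsClosed S := by
      have := (((continuous_id.dist (continuous_const (y := p))).comp_continuousOn hcont)).preimage_isClosed_of_isClosed isClosed_Icc
        (isClosed_Ici (a := ε))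
      exact this
    have hSne : S.Nonempty := ⟨t, ⟨ht, le_rfl⟩, hcon'⟩
    have hSbd : BddBelow S := ⟨t0, fun s hs => hs.1.1⟩
    set t1 := sInf S with ht1
    have ht1S : t1 ∈ S := hScl.csInf_mem hSne hSbd
    have hlt : ∀ s ∈ Set.Ico t0 t1, γ s ∈ Metric.ball p ε := by
      intro s hs
      by_contra hns
      have hsS : s ∈ S := ⟨⟨hs.1, hs.2.le.trans ht1S.1.2⟩, by simpa using hns⟩
      exact absurd (csInf_le hSbd hsS) (not_le.2 hs.2)
    have hB : ∀ s, 0 ≤ s → HasDerivAt (fun s => K * (u t0 ^ q - u s ^ q))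
        (C ^ q * (‖gradient f (γ s)‖ ^ 2 * u s ^ (q - 1))) s := by
      intro s hs
      have h1 := (((hu' s hs).rpow_const (p := q) (Or.inl (hpos s hs).ne')).const_sub
        (u t0 ^ q)).const_mul K
      exact h1.congr_deriv (by rw [hK]; field_simp)
    have hbd := image_norm_le_of_norm_deriv_right_le_deriv_boundary' (a := t0) (b := t1)
      (f := fun s => γ s - γ t0) (f' := fun s => -(gradient f (γ s)))
      (B := fun s => K * (u t0 ^ q - u s ^ q))
      (B' := fun s => C ^ q * (‖gradient f (γ s)‖ ^ 2 * u s ^ (q - 1)))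
      (fun s hs => ((hγ s (hj0.trans hs.1)).sub_const _).continuousAt.continuousWithinAt)
      (fun s hs => ((hγ s (hj0.trans hs.1)).sub_const _).hasDerivWithinAt)
      (by simp)
      (fun s hs => (hB s (hj0.trans hs.1)).continuousAt.continuousWithinAt)
      (fun s hs => (hB s (hj0.trans hs.1)).hasDerivWithinAt)
      (fun s hs => by
        have hs0 := hj0.trans hs.1
        rw [norm_neg]
        refine rpow_aux (u s) _ C N (hpos s hs0) (norm_nonneg _) hC ?_
        have := hball (γ s) (Metric.ball_subset_ball (min_le_right _ _) (hlt s hs))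
        rwa [abs_of_nonneg (hnn s hs0)] at this)
    have h1 := hbd (x := t1) ⟨ht1S.1.1, le_rfl⟩
    have h2 : 0 ≤ u t1 ^ q := Real.rpow_nonneg (hnn t1 (hj0.trans ht1S.1.1)) _
    have h3 : dist (γ t1) (γ t0) ≤ K * (u t0 ^ q - u t1 ^ q) := by rw [dist_eq_norm]; exact h1
    have h4 := dist_triangle (γ t1) (γ t0) p
    have h5 := ht1S.2
    nlinarith [mul_nonneg hK0.le h2]
  · push Not at hpos
    obtain ⟨t0, ht0, hut0⟩ := hpos
    have hz : ∀ t, t0 ≤ t → u t = 0 := fun t ht =>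
      le_antisymm ((hanti ht0 (ht0.trans ht) ht).trans hut0) (hnn t (ht0.trans ht))
    have hgr : ∀ t, t0 < t → gradient f (γ t) = 0 := by
      intro t ht
      have h1 : u =ᶠ[𝓝 t] fun _ => 0 := by
        filter_upwards [lt_mem_nhds ht] with s hs using hz s hs.le
      have h2 := (hu' t (ht0.trans ht.le)).unique ((hasDerivAt_const t (0:ℝ)).congr_of_eventuallyEq h1)
      simpa using h2
    have hconst : ∀ t, t0 + 1 ≤ t → γ t = γ (t0 + 1) := by
      intro t ht
      refine constant_of_has_deriv_right_zero (a := t0 + 1) (b := t) (f := γ) ?_ ?_ t ⟨ht, le_rfl⟩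
      · exact fun s hs => (hγ s (by linarith [hs.1])).continuousAt.continuousWithinAt
      · intro s hs
        have := (hγ s (by linarith [hs.1])).hasDerivWithinAt (s := Set.Ici s)
        rwa [hgr s (by linarith [hs.1]), neg_zero] at this
    have hlim : Tendsto γ atTop (𝓝 (γ (t0 + 1))) := by
      refine tendsto_const_nhds.congr' ?_
      filter_upwards [eventually_ge_atTop (t0+1)] with t ht using (hconst t ht).symm
    rwa [tendsto_nhds_unique (hlim.comp htj) hseq] at hlim

end

/-- If a gradient flow of an analytic function accumulates at a local
minimum `p` along a sequence of times tending to infinity, then it converges to `p`. -/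
theorem gradient_flow_converges_of_seq_limit
    (n : ℕ)
    (f : EuclideanSpace ℝ (Fin n) → ℝ)
    (hf : ∀ x, AnalyticAt ℝ f x)
    (p : EuclideanSpace ℝ (Fin n))
    (hmin : IsLocalMin f p)
    (γ : ℝ → EuclideanSpace ℝ (Fin n))
    (hγ : ∀ t : ℝ, 0 ≤ t → HasDerivAt γ (-(gradient f (γ t))) t)
    (tj : ℕ → ℝ)
    (htj : Tendsto tj atTop atTop)
    (hseq : Tendsto (fun j => γ (tj j)) atTop (nhds p)) :
    Tendsto γ atTop (nhds p) := by
  obtain ⟨N, C, hC, h⟩ := loj_euclid f p (hf p)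
  exact flow_lemma f (fun x => (hf x).differentiableAt) p N C hC h γ hγ tj htj hseq
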